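/- arXiv:1305.6212 — 3 statements merged into one kernel-verified Lean document; each statement's English description precedes it below -/
import Mathlib

section
/- For any two quadruples of generators Q and Q' of A, there exists a chain Q = Q₀, Q₁, ..., Qₙ = Q' of quadruples of generators of A with n ≤ 3 such that each consecutive pair Qᵢ, Qᵢ₊₁ is related by a step of type Λ₃. -/
/-- `x` is an Artin–Schreier element: `x² + x ∈ F·1`. -/
def IsArtinSchreier (F : Type*) {A : Type*} [Field F] [Ring A] [Algebra F A] (x : A) : Prop :=
  x ^ 2 + x ∈ Set.range (algebraMap F A)

/-- `y` is a square-central element: `y² ∈ F·1`. -/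
def IsSquareCentral (F : Type*) {A : Type*} [Field F] [Ring A] [Algebra F A] (y : A) : Prop :=
  y ^ 2 ∈ Set.range (algebraMap F A)

/-- `(x, y, z, u)` is a quadruple of generators of the biquaternion algebra `A`. -/
def IsQuadruple (F : Type*) {A : Type*} [Field F] [Ring A] [Algebra F A]
    (q : A × A × A × A) : Prop :=
  match q with
  | (x, y, z, u) =>
    y ≠ 0 ∧ u ≠ 0 ∧
    IsArtinSchreier F x ∧ IsSquareCentral F y ∧
    IsArtinSchreier F z ∧ IsSquareCentral F u ∧
    x * y + y * x = y ∧ x * z = z * x ∧ x * u = u * x ∧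
    y * z = z * y ∧ y * u = u * y ∧ z * u + u * z = u

/-- Swapping the two pairs of a quadruple: `(x, y, z, u) ↦ (z, u, x, y)`. -/
def quadSwap {A : Type*} (q : A × A × A × A) : A × A × A × A :=
  (q.2.2.1, q.2.2.2, q.1, q.2.1)

/-- At least one of the four entries agrees. -/
def AgreeOne {A : Type*} (q r : A × A × A × A) : Prop :=
  q.1 = r.1 ∨ q.2.1 = r.2.1 ∨ q.2.2.1 = r.2.2.1 ∨ q.2.2.2 = r.2.2.2

/-- A step of type `Λ₃`: after possibly pair-swapping the target quadruple, at least one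
generator is preserved (i.e. at most three generators are changed). -/
def Lambda3Step {A : Type*} (q q' : A × A × A × A) : Prop :=
  AgreeOne q q' ∨ AgreeOne q (quadSwap q')

section CharTwoDivisionRing

variable {A : Type*} [DivisionRing A]

theorem commute_of_mem_center {a : A} (ha : a ∈ Subring.center A) (w : A) : Commute a w :=
  (Subring.mem_center_iff.1 ha w).symm

theorem mem_center_of_forall_commute {a : A} (h : ∀ w, Commute a w) : a ∈ Subring.center A :=
  Subring.mem_center_iff.2 fun w => (h w).eq.symm

theorem inv_mem_center {a : A} (ha : a ∈ Subring.center A) : a⁻¹ ∈ Subring.center A :=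
  mem_center_of_forall_commute fun w => (commute_of_mem_center ha w).inv_left₀

theorem mul_left_rel {x y : A} (h : x * y = y * x + y) (w : A) :
    x * (y * w) = y * (x * w) + y * w := by
  rw [← mul_assoc, h, add_mul, mul_assoc]

theorem mul_mul_self_mem_center {y c : A} (hyy : y * y ∈ Subring.center A)
    (hcc : c * c ∈ Subring.center A) (hcy : Commute c y) :
    (y * c) * (y * c) ∈ Subring.center A := by
  have e : (y * c) * (y * c) = (y * y) * (c * c) := by
    rw [mul_assoc, ← mul_assoc c, hcy.eq, mul_assoc y c, ← mul_assoc]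
  rw [e]
  exact mul_mem hyy hcc

theorem mul_rel {x y c : A} (h : x * y = y * x + y) (hc : Commute c x) :
    x * (y * c) = y * c * x + y * c := by
  rw [mul_left_rel h, mul_assoc y c, hc.eq]

/-- A noncentral quadratic element can be rescaled to an Artin–Schreier or a square-central one. -/
theorem exists_mul_artinSchreier_or_sq {r t : A} (hr : r ∉ Subring.center A)
    (ht : t ∈ Subring.center A) (hrt : r * r + t * r ∈ Subring.center A) :
    ∃ f ∈ Subring.center A, f * r ∉ Subring.center A ∧
      ((f * r) * (f * r) + f * r ∈ Subring.center A ∨ (f * r) * (f * r) ∈ Subring.center A) := by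
  by_cases h0 : t = 0
  · subst h0
    rw [zero_mul, add_zero] at hrt
    exact ⟨1, one_mem _, by rwa [one_mul], .inr (by rwa [one_mul])⟩
  · have hi := inv_mem_center ht
    refine ⟨t⁻¹, hi, fun h => hr ?_, .inl ?_⟩
    · simpa [mul_inv_cancel_left₀ h0] using mul_mem ht h
    · have e : t⁻¹ * r * (t⁻¹ * r) + t⁻¹ * r = t⁻¹ * t⁻¹ * (r * r + t * r) := by
        rw [mul_add, mul_assoc t⁻¹ t⁻¹ (t * r), inv_mul_cancel_left₀ h0, mul_assoc t⁻¹ r,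
          ← mul_assoc r, ← (commute_of_mem_center hi r).eq]
        simp only [mul_assoc]
      rw [e]
      exact mul_mem (mul_mem hi hi) hrt

theorem eq_zero_of_decomp_eq_zero {x y a b c d : A} (hy : y ≠ 0) (hxy : x * y = y * x + y)
    (hax : Commute a x) (hay : Commute a y) (hbx : Commute b x) (hby : Commute b y)
    (hcx : Commute c x) (hcy : Commute c y) (hdx : Commute d x) (hdy : Commute d y)
    (h : a + b * x + (c + d * x) * y = 0) : a = 0 ∧ b = 0 ∧ c = 0 ∧ d = 0 := by
  have hpair {v w : A} (hv : Commute v y) (hw : Commute w y) (h0 : v + w * x = 0) :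
      v = 0 ∧ w = 0 := by
    have e : w * y = 0 := by
      have h1 : (v + w * x) * y = y * (v + w * x) := by rw [h0, zero_mul, mul_zero]
      rw [add_mul, mul_add, mul_assoc, hxy, hv.eq, mul_add, ← mul_assoc, hw.eq, mul_assoc,
        ← add_assoc] at h1
      rw [hw.eq]
      exact left_eq_add.1 h1.symm
    have hw0 : w = 0 := (mul_eq_zero.1 e).resolve_right hy
    exact ⟨by simpa [hw0] using h0, hw0⟩
  have hcd : c + d * x = 0 := by
    have hcomm : Commute (c + d * x) x := hcx.add_left (hdx.mul_left (.refl x))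
    have hcomm' : Commute (a + b * x) x := hax.add_left (hbx.mul_left (.refl x))
    have h1 : x * (a + b * x + (c + d * x) * y) = (a + b * x + (c + d * x) * y) * x := by
      rw [h, zero_mul, mul_zero]
    rw [mul_add x, add_mul _ _ x, hcomm'.eq, ← mul_assoc, ← hcomm.eq, mul_assoc _ x y, hxy] at h1
    have h2 := add_left_cancel h1
    rw [mul_add, ← mul_assoc] at h2
    exact (mul_eq_zero.1 (add_eq_left.1 h2)).resolve_right hy
  rw [hcd, zero_mul, add_zero] at h
  exact ⟨(hpair hay hby h).1, (hpair hay hby h).2, hpair hcy hdy hcd⟩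

/-- The relations between the entries of a quadruple of generators. The entries `x`, `z` are then
automatically Artin–Schreier and `y`, `u` automatically square-central, once the centralizer of the
four entries is trivial. -/
structure GenQuad (x y z u : A) : Prop where
  y_ne : y ≠ 0
  u_ne : u ≠ 0
  xy : x * y = y * x + y
  zu : z * u = u * z + u
  xz : Commute x z
  xu : Commute x u
  yz : Commute y z
  yu : Commute y u

theorem GenQuad.swap {x y z u : A} (h : GenQuad x y z u) : GenQuad z u x y :=
  ⟨h.u_ne, h.y_ne, h.zu, h.xy, h.xz.symm, h.yz.symm, h.xu.symm, h.yu.symm⟩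

variable (A) in
/-- Every quadruple satisfying the relations of generators has trivial centralizer. -/
def GenQuadsGenerate : Prop :=
  ∀ x y z u : A, GenQuad x y z u →
    ∀ w, Commute w x → Commute w y → Commute w z → Commute w u → w ∈ Subring.center A

variable [CharP A 2]

theorem commute_sq_of_rel {x y : A} (h : x * y = y * x + y) : Commute (y * y) x := by
  have h' := mul_left_rel h
  simp only [Commute, SemiconjBy, mul_add, mul_assoc, h, h', add_comm, CharTwo.add_cancel_left]

theorem commute_artinSchreier_of_rel {x y : A} (h : x * y = y * x + y) :
    Commute (x * x + x) y := by
  have h' := mul_left_rel h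
  simp only [Commute, SemiconjBy, mul_add, add_mul, mul_assoc, h, h', add_comm, add_left_comm,
    add_assoc, CharTwo.add_cancel_left]

theorem GenQuad.sq_mem {x y z u : A} (hA : GenQuadsGenerate A) (h : GenQuad x y z u) :
    y * y ∈ Subring.center A :=
  hA x y z u h _ (commute_sq_of_rel h.xy) ((Commute.refl y).mul_left (Commute.refl y))
    (h.yz.mul_left h.yz) (h.yu.mul_left h.yu)

theorem GenQuad.artinSchreier_mem {x y z u : A} (hA : GenQuadsGenerate A)
    (h : GenQuad x y z u) : x * x + x ∈ Subring.center A :=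
  hA x y z u h _ (((Commute.refl x).mul_left (Commute.refl x)).add_left (Commute.refl x))
    (commute_artinSchreier_of_rel h.xy)
    ((h.xz.mul_left h.xz).add_left h.xz) ((h.xu.mul_left h.xu).add_left h.xu)

theorem exists_decomp_of_commute {x y s : A} (hy : y ≠ 0) (h : x * y = y * x + y)
    (hyy : y * y ∈ Subring.center A) (hs : Commute s x) :
    ∃ b c, s = b + c * x ∧ Commute b x ∧ Commute b y ∧ Commute c x ∧ Commute c y ∧
      ∀ w, Commute w x → Commute w y → Commute w s → Commute w b ∧ Commute w c := by
  have h' := mul_left_rel h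
  have hc : ∃ c, s * y = y * s + y * c := ⟨y⁻¹ * (s * y + y * s), by
    rw [mul_inv_cancel_left₀ hy, add_comm (s * y), CharTwo.add_cancel_left]⟩
  obtain ⟨c, hc⟩ := hc
  have hc' (w : A) : s * (y * w) = y * (s * w) + y * (c * w) := by
    rw [← mul_assoc, hc]; noncomm_ring
  have hcdef : c = y⁻¹ * (s * y + y * s) := by
    rw [hc, add_comm, CharTwo.add_cancel_left, inv_mul_cancel_left₀ hy]
  have hcx : Commute c x := by
    have e : y * (c * x) = y * (x * c) := by
      have e1 : s * (x * y) + x * (s * y) = 0 := by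
        rw [hs.left_comm, CharTwo.add_self_eq_zero]
      rw [← CharTwo.add_eq_zero, ← e1]
      simp only [mul_add, h, h', hc, hc', hs.eq, add_comm, add_left_comm, add_assoc,
        CharTwo.add_cancel_left]
    exact mul_left_cancel₀ hy e
  have hcy : Commute c y := by
    have e : s * (y * y) = y * y * s := ((commute_of_mem_center hyy s).eq).symm
    have e2 : y * (c * y + y * c) = 0 := by
      have e3 : s * (y * y) + y * y * s = 0 := by rw [e, CharTwo.add_self_eq_zero]
      rw [← e3]
      simp only [mul_add, mul_assoc, hc, hc', add_comm, add_assoc, CharTwo.add_cancel_left]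
    exact CharTwo.add_eq_zero.1 ((mul_eq_zero.1 e2).resolve_left hy)
  refine ⟨s + c * x, c, by rw [CharTwo.add_cancel_right], hs.add_left (hcx.mul_left (.refl x)),
    ?_, hcx, hcy, ?_⟩
  · have h2 := hcy.left_comm
    have h1 := hcy.eq
    simp only [Commute, SemiconjBy, mul_add, add_mul, mul_assoc, h, hc, h1, h2, add_comm,
      add_left_comm, add_assoc, CharTwo.add_cancel_left]
  · intro w wx wy ws
    have wc : Commute w c := by
      rw [hcdef]
      exact wy.inv_right₀.mul_right ((ws.mul_right wy).add_right (wy.mul_right ws))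
    exact ⟨ws.add_right (wc.mul_right wx), wc⟩

theorem exists_decomp {x y : A} (hy : y ≠ 0) (h : x * y = y * x + y)
    (hxx : x * x + x ∈ Subring.center A) (r : A) :
    ∃ p q, r = p + q * y ∧ Commute p x ∧ Commute q x ∧
      ∀ w, Commute w x → Commute w y → Commute w r → Commute w p ∧ Commute w q := by
  have e : (x * x + x) * r + r * (x * x + x) = 0 := by
    rw [(commute_of_mem_center hxx r).eq, CharTwo.add_self_eq_zero]
  have hd : x * (x * r + r * x) = (x * r + r * x) * x + (x * r + r * x) := by
    rw [← CharTwo.add_eq_zero, ← e]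
    simp only [mul_add, add_mul, mul_assoc, add_comm, add_left_comm, add_assoc,
      CharTwo.add_cancel_left]
  have hq : Commute ((x * r + r * x) * y⁻¹) x := by
    have e2 : x * y⁻¹ = y⁻¹ * x + y⁻¹ := by
      apply mul_left_cancel₀ hy
      apply mul_right_cancel₀ hy
      have e3 : y * x = x * y + y := by rw [h, CharTwo.add_cancel_right]
      rw [← mul_assoc, mul_assoc, inv_mul_cancel₀ hy, mul_one, mul_add, mul_inv_cancel_left₀ hy,
        mul_inv_cancel₀ hy, add_mul, one_mul, e3]
    have h1 : x * ((x * r + r * x) * y⁻¹) = (x * r + r * x) * y⁻¹ * x := by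
      rw [← mul_assoc, hd, add_mul, mul_assoc, e2, mul_add, ← mul_assoc,
        CharTwo.add_cancel_right]
    exact h1.symm
  refine ⟨r + (x * r + r * x), (x * r + r * x) * y⁻¹, ?_, ?_, hq, ?_⟩
  · rw [inv_mul_cancel_right₀ hy, CharTwo.add_cancel_right]
  · have h1 : x * (r + (x * r + r * x)) = (r + (x * r + r * x)) * x := by
      rw [mul_add, hd]
      simp only [add_mul, add_comm, add_assoc, CharTwo.add_cancel_left]
    exact h1.symm
  · intro w wx wy wr
    have := (wx.mul_right wr).add_right (wr.mul_right wx)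
    exact ⟨wr.add_right this, this.mul_right wy.inv_right₀⟩

theorem exists_not_commute {x y h : A} (hy : y ≠ 0) (hxy : x * y = y * x + y)
    (hxx : x * x + x ∈ Subring.center A) (hyy : y * y ∈ Subring.center A)
    (hx : Commute h x) (hy' : Commute h y) (hh : h ∉ Subring.center A) :
    ∃ r, Commute r x ∧ Commute r y ∧ h * r + r * h ≠ 0 := by
  by_contra! H
  have H' (r : A) (h1 : Commute r x) (h2 : Commute r y) : Commute h r :=
    CharTwo.add_eq_zero.1 (H r h1 h2)
  have H2 (s : A) (hs : Commute s x) : Commute h s := by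
    obtain ⟨b, c, rfl, hbx, hby, hcx, hcy, -⟩ := exists_decomp_of_commute hy hxy hyy hs
    exact (H' b hbx hby).add_right ((H' c hcx hcy).mul_right hx)
  refine hh (mem_center_of_forall_commute fun g => ?_)
  obtain ⟨p, q, rfl, hp, hq, -⟩ := exists_decomp hy hxy hxx g
  exact (H2 p hp).add_right ((H2 q hq).mul_right hy')

theorem exists_genQuad_of_artinSchreier {x y h : A} (hy : y ≠ 0) (hxy : x * y = y * x + y)
    (hxx : x * x + x ∈ Subring.center A) (hyy : y * y ∈ Subring.center A)
    (hx : Commute h x) (hy' : Commute h y) (hh : h ∉ Subring.center A)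
    (hhh : h * h + h ∈ Subring.center A) : ∃ u, GenQuad x y h u := by
  obtain ⟨r, hrx, hry, hr⟩ := exists_not_commute hy hxy hxx hyy hx hy' hh
  refine ⟨h * r + r * h, hy, hr, hxy, ?_, hx.symm, ?_, hy'.symm, ?_⟩
  · have e : (h * h + h) * r + r * (h * h + h) = 0 := by
      rw [(commute_of_mem_center hhh r).eq, CharTwo.add_self_eq_zero]
    rw [← CharTwo.add_eq_zero, ← e]
    simp only [mul_add, add_mul, mul_assoc, add_comm, add_left_comm, add_assoc,
      CharTwo.add_cancel_left]
  · exact ((hx.mul_left hrx).add_left (hrx.mul_left hx)).symm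
  · exact ((hy'.mul_left hry).add_left (hry.mul_left hy')).symm

theorem exists_genQuad_of_sq {x y h : A} (hy : y ≠ 0) (hxy : x * y = y * x + y)
    (hxx : x * x + x ∈ Subring.center A) (hyy : y * y ∈ Subring.center A)
    (hx : Commute h x) (hy' : Commute h y) (hh : h ∉ Subring.center A)
    (hhh : h * h ∈ Subring.center A) : ∃ z, GenQuad x y z h := by
  obtain ⟨r, hrx, hry, hr⟩ := exists_not_commute hy hxy hxx hyy hx hy' hh
  obtain ⟨m, hm⟩ : ∃ m, m = h * r + r * h := ⟨_, rfl⟩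
  have hmh : Commute m h := by
    have e : h * h * r + r * (h * h) = 0 := by
      rw [(commute_of_mem_center hhh r).eq, CharTwo.add_self_eq_zero]
    refine CharTwo.add_eq_zero.1 ?_
    rw [← e, hm]
    simp only [mul_add, add_mul, mul_assoc, add_comm, add_left_comm, add_assoc,
      CharTwo.add_cancel_left]
  have hmx : Commute m x := hm ▸ (hx.mul_left hrx).add_left (hrx.mul_left hx)
  have hmy : Commute m y := hm ▸ (hy'.mul_left hry).add_left (hry.mul_left hy')
  rw [← hm] at hr
  refine ⟨r * (m⁻¹ * h), hy, ?_, hxy, ?_, ?_, hx.symm, ?_, hy'.symm⟩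
  · rintro rfl
    simp at hm
    exact hr hm
  · have h1 : h * r = r * h + m := by
      rw [hm, add_comm (h * r), CharTwo.add_cancel_left]
    have h2 : m⁻¹ * h = h * m⁻¹ := hmh.inv_left₀.eq
    rw [h2, ← mul_assoc, ← mul_assoc, ← mul_assoc, h1, add_mul, add_mul, mul_assoc m h,
      ← h2, mul_inv_cancel_left₀ hr, mul_assoc (r * h), h2, ← mul_assoc, add_assoc,
      CharTwo.add_self_eq_zero, add_zero]
  · exact (hrx.mul_left (hmx.inv_left₀.mul_left hx)).symm
  · exact (hry.mul_left (hmy.inv_left₀.mul_left hy')).symm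

theorem GenQuad.exists_eq_add_mul {x y z u v : A} (hA : GenQuadsGenerate A)
    (h : GenQuad x y z u) (hx : Commute v x) (hz : Commute v z) (hu : Commute v u) :
    ∃ a ∈ Subring.center A, ∃ b ∈ Subring.center A, v = a + b * x := by
  obtain ⟨a, b, e, hax, hay, hbx, hby, H⟩ :=
    exists_decomp_of_commute h.y_ne h.xy (h.sq_mem hA) hx
  have hz := H z h.xz.symm h.yz.symm hz.symm
  have hu := H u h.xu.symm h.yu.symm hu.symm
  exact ⟨a, hA x y z u h a hax hay hz.1.symm hu.1.symm, b,
    hA x y z u h b hbx hby hz.2.symm hu.2.symm, e⟩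

theorem GenQuad.commute_of_commute {x y z u v w : A} (hA : GenQuadsGenerate A)
    (h : GenQuad x y z u) (hx : Commute v x) (hz : Commute v z) (hu : Commute v u)
    (hw : Commute w x) : Commute v w := by
  obtain ⟨a, ha, b, hb, rfl⟩ := h.exists_eq_add_mul hA hx hz hu
  exact (commute_of_mem_center ha w).add_left ((commute_of_mem_center hb w).mul_left hw.symm)

theorem norm_identity {a α β z : A} (hz : z * z = z + a) (hβα : Commute β α)
    (hzα : Commute z α) (hzβ : Commute z β) :
    (α + β * z) * (α + β * z) + β * (α + β * z) = α * α + α * β + β * β * a := by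
  simp only [mul_add, add_mul, mul_assoc, add_comm, add_left_comm, hz, hβα.eq, hzα.eq,
    hβα.left_comm, hzβ.left_comm, add_assoc, CharTwo.add_self_eq_zero, CharTwo.add_cancel_left,
    add_zero]

theorem quadratic_identity {b p r β δ u : A} (hu : u * u = b)
    (hup : u * p = p * u + β * u) (hur : u * r = r * u + δ * u)
    (hrp : Commute r p) (hβr : Commute β r) (hδr : Commute δ r) :
    (p + r * u) * (p + r * u) + β * (p + r * u) = (p * p + β * p) + (r * r + δ * r) * b := by
  have hur' (w : A) : u * (r * w) = r * (u * w) + δ * (u * w) := by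
    rw [← mul_assoc, hur, add_mul, mul_assoc, mul_assoc]
  simp only [mul_add, add_mul, mul_assoc, add_comm, add_left_comm, hu, hup, hur', hrp.left_comm,
    hβr.left_comm, hδr.eq, add_assoc, CharTwo.add_cancel_left]

theorem GenQuad.exists_quadratic {x y z u q : A} (hA : GenQuadsGenerate A)
    (h : GenQuad x y z u) (hq : Commute q x) :
    ∃ t, (Commute t x ∧ Commute t z ∧ Commute t u) ∧
      (Commute (q * q + t * q) z ∧ Commute (q * q + t * q) u) ∧
      ∀ w, Commute w z → Commute w u → Commute w q → Commute w t := by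
  have hzz := h.swap.artinSchreier_mem hA
  have huu := h.swap.sq_mem hA
  obtain ⟨p, r, rfl, hpz, hrz, H⟩ := exists_decomp h.u_ne h.zu hzz q
  have Hx := H x h.xz h.xu hq.symm
  obtain ⟨α, β, rfl, hαz, hαu, hβz, hβu, H1⟩ :=
    exists_decomp_of_commute h.u_ne h.zu huu hpz
  obtain ⟨γ, δ, rfl, hγz, hγu, hδz, hδu, H2⟩ :=
    exists_decomp_of_commute h.u_ne h.zu huu hrz
  have hx1 := H1 x h.xz h.xu Hx.1
  have hx2 := H2 x h.xz h.xu Hx.2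
  have hcomm {v w : A} (hx : Commute x v) (hz : Commute v z) (hu : Commute v u)
    (hw : Commute x w) : Commute v w := h.commute_of_commute hA hx.symm hz hu hw.symm
  have hz : z * z = z + (z * z + z) := by rw [add_comm, CharTwo.add_cancel_right]
  have huz : u * z = z * u + u := by rw [h.zu, CharTwo.add_cancel_right]
  have hu {v w : A} (hv : Commute v u) (hw : Commute w u) :
      u * (v + w * z) = (v + w * z) * u + w * u := by
    rw [mul_add, ← mul_assoc, ← hw.eq, mul_assoc, huz, ← hv.eq]
    noncomm_ring
  have hβα := hcomm hx1.2 hβz hβu hx1.1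
  have hδγ := hcomm hx2.2 hδz hδu hx2.1
  have key := quadratic_identity (b := u * u) rfl (hu hαu hβu) (hu hγu hδu)
    ((hcomm hx1.1 hαz hαu Hx.2).add_left
      ((hcomm hx1.2 hβz hβu Hx.2).mul_left hrz.symm)).symm
    (hcomm hx1.2 hβz hβu Hx.2) (hcomm hx2.2 hδz hδu Hx.2)
  rw [norm_identity hz hβα hαz.symm hβz.symm, norm_identity hz hδγ hγz.symm hδz.symm] at key
  refine ⟨β, ⟨hx1.2.symm, hβz, hβu⟩, ?_, fun w hz hu hw => ?_⟩
  · have hn {v v' w : A} (hv : Commute v w) (hv' : Commute v' w) :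
        Commute (v * v + v * v' + v' * v' * (z * z + z)) w :=
      ((hv.mul_left hv).add_left (hv.mul_left hv')).add_left
        ((hv'.mul_left hv').mul_left (commute_of_mem_center hzz w))
    rw [key]
    exact ⟨(hn hαz hβz).add_left ((hn hγz hδz).mul_left (commute_of_mem_center huu z)),
      (hn hαu hβu).add_left ((hn hγu hδu).mul_left (commute_of_mem_center huu u))⟩
  · exact (H1 w hz hu (H w hz hu hw).1).2

theorem GenQuad.exists_center_quadratic {x y z u q : A} (hA : GenQuadsGenerate A)
    (h : GenQuad x y z u) (hx : Commute q x) (hy : Commute q y) :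
    ∃ t ∈ Subring.center A, q * q + t * q ∈ Subring.center A := by
  obtain ⟨t, ⟨htx, htz, htu⟩, ⟨hnz, hnu⟩, H⟩ := h.exists_quadratic hA hx
  have hty := (H y h.yz h.yu hy.symm).symm
  exact ⟨t, hA x y z u h t htx hty htz htu, hA x y z u h _
    ((hx.mul_left hx).add_left (htx.mul_left hx)) ((hy.mul_left hy).add_left (hty.mul_left hy))
    hnz hnu⟩

theorem sq_mem_or_commute {h t q : A} (ht : t ∈ Subring.center A)
    (hq : q * q + t * q ∈ Subring.center A) (hc : Commute (h * q + q * h) q) :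
    q * q ∈ Subring.center A ∨ Commute h q := by
  have e : t * (h * q + q * h) = 0 := by
    have h1 : h * (q * q + t * q) + (q * q + t * q) * h = 0 := by
      rw [(commute_of_mem_center hq h).eq, CharTwo.add_self_eq_zero]
    have h2 : (h * q + q * h) * q + q * (h * q + q * h) = 0 := by
      rw [hc.eq, CharTwo.add_self_eq_zero]
    have h3 := commute_of_mem_center ht h
    rw [← add_zero 0]
    nth_rw 1 [← h1]
    rw [← h2]
    simp only [mul_add, add_mul, mul_assoc, h3.symm.left_comm, add_comm, add_left_comm, add_assoc,
      CharTwo.add_self_eq_zero, CharTwo.add_cancel_left, add_zero]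
  rcases mul_eq_zero.1 e with h0 | h0
  · left
    simpa [h0] using hq
  · exact .inr (CharTwo.add_eq_zero.1 h0)

theorem GenQuad.exists_shift {x y z u h : A} (hA : GenQuadsGenerate A)
    (hQ : GenQuad x y z u) (hx : Commute h x) :
    ∃ c, Commute c x ∧ Commute c y ∧ h * y = y * h + y * c ∧
      ∃ t ∈ Subring.center A, c * c + t * c ∈ Subring.center A := by
  obtain ⟨b, c, rfl, hbx, hby, hcx, hcy, -⟩ :=
    exists_decomp_of_commute hQ.y_ne hQ.xy (hQ.sq_mem hA) hx
  refine ⟨c, hcx, hcy, ?_, hQ.exists_center_quadratic hA hcx hcy⟩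
  rw [add_mul, mul_assoc, hQ.xy, mul_add, ← mul_assoc, hby.eq, hcy.eq, mul_add, mul_assoc,
    add_assoc]

theorem GenQuad.exists_containing_artinSchreier {x y z u h : A} (hA : GenQuadsGenerate A)
    (hQ : GenQuad x y z u) (hx : Commute h x) (hh : h ∉ Subring.center A)
    (hhh : h * h + h ∈ Subring.center A) (hhx : h + x ∉ Subring.center A) :
    ∃ y' u', GenQuad x y' h u' := by
  have hxx := hQ.artinSchreier_mem hA
  have hyy := hQ.sq_mem hA
  obtain ⟨c, hcx, hcy, hc, t, ht, hct⟩ := hQ.exists_shift hA hx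
  have hhc : h * c + c * h + (c * c + c) = 0 := by
    have e : (h * h + h) * y + y * (h * h + h) = 0 := by
      rw [(commute_of_mem_center hhh y).eq, CharTwo.add_self_eq_zero]
    have hc' (w : A) : h * (y * w) = y * (h * w) + y * (c * w) := by
      rw [← mul_assoc, hc]; noncomm_ring
    refine (mul_eq_zero.1 (?_ : y * _ = 0)).resolve_left hQ.y_ne
    rw [← e]
    simp only [mul_add, add_mul, mul_assoc, hc, hc', add_comm, add_left_comm, add_assoc,
      CharTwo.add_cancel_left]
  by_cases hc1 : c = 1
  · subst hc1
    have hq : (h + x) * (h + x) + (h + x) ∈ Subring.center A := by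
      have e : (h + x) * (h + x) + (h + x) = (h * h + h) + (x * x + x) := by
        simp only [mul_add, add_mul, hx.eq, add_comm, add_left_comm, add_assoc,
          CharTwo.add_cancel_left]
      rw [e]
      exact add_mem hhh hxx
    have hqy : Commute (h + x) y := by
      rw [Commute, SemiconjBy, add_mul, mul_add, hc, hQ.xy, mul_one, add_add_add_comm,
        CharTwo.add_self_eq_zero, add_zero]
    obtain ⟨v, hv⟩ := exists_genQuad_of_artinSchreier hQ.y_ne hQ.xy hxx hyy
      (hx.add_left (.refl x)) hqy hhx hq
    have hhv : h * v = v * h + v := by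
      have := hv.zu
      rw [add_mul, mul_add, hv.xu.eq, add_right_comm] at this
      exact add_right_cancel this
    have hvy := hv.yu.symm.eq
    refine ⟨y * v, v, mul_ne_zero hQ.y_ne hv.u_ne, hv.u_ne, mul_rel hQ.xy hv.xu.symm,
      hhv, hx.symm, hv.xu, ?_, hv.yu.mul_left (.refl v)⟩
    refine Eq.symm (?_ : h * (y * v) = y * v * h)
    rw [← mul_assoc, hc, add_mul, mul_assoc, hhv, mul_one, mul_add, add_assoc,
      CharTwo.add_self_eq_zero, add_zero, mul_assoc]
  · have hcc : c * c ∈ Subring.center A := by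
      have hr : h * c + c * h = c * c + c := CharTwo.add_eq_zero.1 hhc
      rcases sq_mem_or_commute (h := h) ht hct
        (hr ▸ ((Commute.refl c).mul_left (.refl c)).add_left (.refl c)) with H | H
      · exact H
      · rw [H.eq, CharTwo.add_self_eq_zero, zero_add] at hhc
        have : c * (c + 1) = 0 := by rw [mul_add, mul_one, hhc]
        rcases mul_eq_zero.1 this with h0 | h0
        · simp [h0, zero_mem]
        · exact absurd (CharTwo.add_eq_zero.1 h0) hc1
    have hc1x : Commute (1 + c) x := (Commute.one_left x).add_left hcx
    have hcc1 : (1 + c) * (1 + c) ∈ Subring.center A := by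
      have e : (1 + c) * (1 + c) = 1 + c * c := by
        simp only [mul_add, add_mul, one_mul, mul_one, add_assoc, CharTwo.add_cancel_left]
      rw [e]
      exact add_mem (one_mem _) hcc
    have hhy : Commute h (y * (1 + c)) := by
      have hc' (w : A) : h * (y * w) = y * (h * w) + y * (c * w) := by
        rw [← mul_assoc, hc]; noncomm_ring
      refine CharTwo.add_eq_zero.1 ?_
      rw [← mul_zero y, ← hhc]
      simp only [mul_add, add_mul, mul_assoc, hc, hc', add_comm, add_left_comm, mul_one, add_assoc,
        CharTwo.add_cancel_left]
    obtain ⟨v, hv⟩ := exists_genQuad_of_artinSchreier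
      (mul_ne_zero hQ.y_ne fun h0 => hc1 (CharTwo.add_eq_zero.1 h0).symm)
      (mul_rel hQ.xy hc1x) hxx
      (mul_mul_self_mem_center hyy hcc1 ((Commute.one_left y).add_left hcy)) hx hhy hh hhh
    exact ⟨_, v, hv⟩

theorem GenQuad.exists_containing_sq {x y z u h : A} (hA : GenQuadsGenerate A)
    (hQ : GenQuad x y z u) (hx : Commute h x) (hh : h ∉ Subring.center A)
    (hhh : h * h ∈ Subring.center A) : ∃ y' z', GenQuad x y' z' h := by
  have hxx := hQ.artinSchreier_mem hA
  have hyy := hQ.sq_mem hA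
  obtain ⟨c, hcx, hcy, hc, t, ht, hct⟩ := hQ.exists_shift hA hx
  have hc' (w : A) : h * (y * w) = y * (h * w) + y * (c * w) := by
    rw [← mul_assoc, hc]; noncomm_ring
  have hhc : h * c + c * h + c * c = 0 := by
    have e : h * h * y + y * (h * h) = 0 := by
      rw [(commute_of_mem_center hhh y).eq, CharTwo.add_self_eq_zero]
    refine (mul_eq_zero.1 (?_ : y * _ = 0)).resolve_left hQ.y_ne
    rw [← e]
    simp only [mul_add, mul_assoc, hc, hc', add_comm, add_left_comm, add_assoc,
      CharTwo.add_cancel_left]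
  by_cases hc0 : c = 0
  · rw [hc0, mul_zero, add_zero] at hc
    obtain ⟨v, hv⟩ := exists_genQuad_of_sq hQ.y_ne hQ.xy hxx hyy hx hc hh hhh
    exact ⟨y, v, hv⟩
  · have hcc : c * c ∈ Subring.center A := by
      have hr : h * c + c * h = c * c := CharTwo.add_eq_zero.1 hhc
      rcases sq_mem_or_commute (h := h) ht hct
        (hr ▸ (Commute.refl c).mul_left (.refl c)) with H | H
      · exact H
      · rw [H.eq, CharTwo.add_self_eq_zero, zero_add] at hhc
        rw [hhc]
        exact zero_mem _
    have hhy : Commute h (y * c) := by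
      refine CharTwo.add_eq_zero.1 ?_
      rw [← mul_zero y, ← hhc]
      simp only [mul_add, mul_assoc, hc', add_comm, add_left_comm, add_assoc]
    obtain ⟨v, hv⟩ := exists_genQuad_of_sq (mul_ne_zero hQ.y_ne hc0) (mul_rel hQ.xy hcx) hxx
      (mul_mul_self_mem_center hyy hcc hcy) hx hhy hh hhh
    exact ⟨_, v, hv⟩

theorem GenQuad.exists_extending {x y z u s : A} (hA : GenQuadsGenerate A)
    (hQ : GenQuad x y z u) (hs : s ≠ 0) (hxs : x * s = s * x + s)
    (hss : s * s ∈ Subring.center A) : ∃ z' u', GenQuad x s z' u' := by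
  have hxx := hQ.artinSchreier_mem hA
  have hyy := hQ.sq_mem hA
  have hxy := hQ.xy
  obtain ⟨r, hr, hrx, hrs, t, ht, hrt⟩ : ∃ r, r ∉ Subring.center A ∧ Commute r x ∧
      Commute r s ∧ ∃ t ∈ Subring.center A, r * r + t * r ∈ Subring.center A := by
    obtain ⟨c, rfl⟩ : ∃ c, s = y * c := ⟨y⁻¹ * s, by rw [mul_inv_cancel_left₀ hQ.y_ne]⟩
    have hc0 : c ≠ 0 := right_ne_zero_of_mul hs
    have hcx : Commute c x := by
      rw [← mul_assoc, hxy, add_mul, mul_assoc, mul_assoc] at hxs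
      exact (mul_left_cancel₀ hQ.y_ne (add_right_cancel hxs)).symm
    obtain ⟨a, b, hcab, hax, hay, hbx, hby, -⟩ :=
      exists_decomp_of_commute hQ.y_ne hQ.xy hyy hcx
    have hcy : c * y = y * (c + b) := by
      rw [hcab, add_mul, mul_assoc, hxy, mul_add, ← mul_assoc, hby.eq, hay.eq]
      noncomm_ring
    have hcb : Commute c b := by
      have h1 : (c + b) * c ∈ Subring.center A := by
        have e : (c + b) * c = (y * y)⁻¹ * (y * c * (y * c)) := by
          rw [mul_assoc y c, ← mul_assoc c, hcy, mul_assoc, ← mul_assoc y y,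
            inv_mul_cancel_left₀ (mul_ne_zero hQ.y_ne hQ.y_ne)]
        rw [e]
        exact mul_mem (inv_mem_center hyy) hss
      have h2 := (commute_of_mem_center h1 c).eq
      rw [← mul_assoc] at h2
      have h3 := mul_right_cancel₀ hc0 h2
      rw [add_mul, mul_add] at h3
      exact (add_left_cancel h3).symm
    by_cases hb : b ∈ Subring.center A
    · by_cases ha : a ∈ Subring.center A
      · refine ⟨z, fun hz => hQ.u_ne ?_, hQ.xz.symm, hQ.yz.symm.mul_right ?_, 1, one_mem _, ?_⟩
        · have := hQ.zu
          rwa [(commute_of_mem_center hz u).eq, left_eq_add] at this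
        · rw [hcab]
          exact (commute_of_mem_center ha z).symm.add_right
            ((commute_of_mem_center hb z).symm.mul_right hQ.xz.symm)
        · rw [one_mul]
          exact hQ.swap.artinSchreier_mem hA
      · refine ⟨a, ha, hax, hay.mul_right ?_, hQ.exists_center_quadratic hA hax hay⟩
        rw [hcab]
        exact (Commute.refl a).add_right ((commute_of_mem_center hb a).symm.mul_right hax)
    · exact ⟨b, hb, hbx, hby.mul_right hcb.symm, hQ.exists_center_quadratic hA hbx hby⟩
  obtain ⟨f, hf, hfr, H⟩ := exists_mul_artinSchreier_or_sq hr ht hrt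
  have hfx := (commute_of_mem_center hf x).mul_left hrx
  have hfs := (commute_of_mem_center hf s).mul_left hrs
  rcases H with H | H
  · exact ⟨_, exists_genQuad_of_artinSchreier hs hxs hxx hss hfx hfs hfr H⟩
  · obtain ⟨v, hv⟩ := exists_genQuad_of_sq hs hxs hxx hss hfx hfs hfr H
    exact ⟨v, _, hv⟩

theorem GenQuad.exists_linking {x y z u x' y' z' u' : A} (hA : GenQuadsGenerate A)
    (hQ : GenQuad x y z u) (hQ' : GenQuad x' y' z' u') (hc : ¬ Commute x x') :
    ∃ y₁ z₁ u₁ y₂ z₂ u₂, GenQuad x y₁ z₁ u₁ ∧ GenQuad x' y₂ z₂ u₂ ∧ (z₁ = z₂ ∨ u₁ = u₂) := by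
  have hxx := hQ.artinSchreier_mem hA
  have hxx' := hQ'.artinSchreier_mem hA
  obtain ⟨s, hs⟩ : ∃ s, s = x * x' + x' * x := ⟨_, rfl⟩
  have hs0 : s ≠ 0 := fun h0 => hc (CharTwo.add_eq_zero.1 (hs.symm.trans h0))
  have hx'x : x' * x = x * x' + s := by rw [hs, CharTwo.add_cancel_left]
  have hxs : x * s = s * x + s := by
    have e : (x * x + x) * x' + x' * (x * x + x) = 0 := by
      rw [(commute_of_mem_center hxx x').eq, CharTwo.add_self_eq_zero]
    rw [← CharTwo.add_eq_zero, ← e, hs]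
    simp only [mul_add, add_mul, mul_assoc, add_comm, add_left_comm, add_assoc,
      CharTwo.add_cancel_left]
  have hxs' : x' * s = s * x' + s := by
    have e : (x' * x' + x') * x + x * (x' * x' + x') = 0 := by
      rw [(commute_of_mem_center hxx' x).eq, CharTwo.add_self_eq_zero]
    rw [← CharTwo.add_eq_zero, ← e, hs]
    simp only [mul_add, add_mul, mul_assoc, add_comm, add_left_comm, add_assoc,
      CharTwo.add_cancel_left]
  obtain ⟨α, hα⟩ : ∃ α, α = x + x' + s := ⟨_, rfl⟩
  have hαx : Commute α x := by
    rw [Commute, SemiconjBy, hα]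
    simp only [mul_add, add_mul, hx'x, hxs, add_comm, add_left_comm, add_assoc]
  have hαx' : Commute α x' := by
    rw [Commute, SemiconjBy, hα]
    simp only [mul_add, add_mul, hx'x, hxs', add_comm, add_left_comm, add_assoc,
      CharTwo.add_cancel_left]
  by_cases hαc : α ∈ Subring.center A
  · have hx' : x' = x + s + α := by
      rw [hα]
      simp only [add_comm, add_left_comm, CharTwo.add_self_eq_zero, CharTwo.add_cancel_left,
        add_zero]
    have hss : s * s ∈ Subring.center A := by
      have e : s * s = (x' * x' + x') + (x * x + x) + (α * α + α) := by
        rw [hx']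
        simp only [mul_add, add_mul, hxs, hαx.eq, (commute_of_mem_center hαc s).eq, add_comm,
          add_left_comm, add_assoc, CharTwo.add_self_eq_zero, CharTwo.add_cancel_left, add_zero]
      rw [e]
      exact add_mem (add_mem hxx' hxx) (add_mem (mul_mem hαc hαc) hαc)
    obtain ⟨z₁, u₁, h₁⟩ := hQ.exists_extending hA hs0 hxs hss
    have hx'c {w : A} (h1 : Commute x w) (h2 : Commute s w) : Commute x' w :=
      hx' ▸ (h1.add_left h2).add_left (commute_of_mem_center hαc w)
    exact ⟨s, z₁, u₁, s, z₁, u₁, h₁, ⟨hs0, h₁.u_ne, hxs', h₁.zu, hx'c h₁.xz h₁.yz,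
      hx'c h₁.xu h₁.yu, h₁.yz, h₁.yu⟩, .inl rfl⟩
  · have hαs : Commute α s := hs ▸ (hαx.mul_right hαx').add_right (hαx'.mul_right hαx)
    obtain ⟨t, ⟨htx, htz, htu⟩, ⟨hnz, hnu⟩, -⟩ := hQ.exists_quadratic hA hαx
    obtain ⟨t₀, ht₀, t₁, ht₁, rfl⟩ := hQ.exists_eq_add_mul hA htx htz htu
    obtain ⟨n₀, hn₀, n₁, hn₁, hn⟩ := hQ.exists_eq_add_mul hA
      ((hαx.mul_left hαx).add_left (htx.mul_left hαx)) hnz hnu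
    have ht₀s := commute_of_mem_center ht₀ s
    have ht₁s := commute_of_mem_center ht₁ s
    have hn₀s := commute_of_mem_center hn₀ s
    have hn₁s := commute_of_mem_center hn₁ s
    have key : s * (t₁ * α + n₁) = 0 := by
      have e : (α * α + (t₀ + t₁ * x) * α) * s + s * (α * α + (t₀ + t₁ * x) * α) +
          ((n₀ + n₁ * x) * s + s * (n₀ + n₁ * x)) = 0 := by
        rw [hn, CharTwo.add_self_eq_zero]
      rw [← e]
      have hxs2 := mul_left_rel hxs
      simp only [mul_add, add_mul, mul_assoc, hxs, hxs2, hαs.eq, hαs.left_comm, ht₀s.left_comm,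
        ht₁s.left_comm, hn₀s.eq, hn₁s.eq, hn₁s.left_comm, add_comm, add_left_comm, add_assoc,
        CharTwo.add_self_eq_zero, CharTwo.add_cancel_left, add_zero]
    have hn₁α : t₁ * α = n₁ := CharTwo.add_eq_zero.1 ((mul_eq_zero.1 key).resolve_left hs0)
    have ht₁0 : t₁ = 0 := by
      by_contra h0
      refine hαc ?_
      rw [← inv_mul_cancel_left₀ h0 α, hn₁α]
      exact mul_mem (inv_mem_center ht₁) hn₁
    have hn₁0 : n₁ = 0 := by rw [← hn₁α, ht₁0, zero_mul]
    rw [ht₁0, hn₁0, zero_mul, add_zero, add_zero] at hn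
    obtain ⟨f, hf, hfα, H⟩ := exists_mul_artinSchreier_or_sq hαc ht₀ (hn ▸ hn₀)
    have hfx := (commute_of_mem_center hf x).mul_left hαx
    have hfx' := (commute_of_mem_center hf x').mul_left hαx'
    rcases H with H | H
    · obtain ⟨y₁, u₁, h₁⟩ := hQ.exists_containing_artinSchreier hA hfx hfα H fun hm => hc (by
        have h2 := (commute_of_mem_center hm x').sub_left hfx'
        rwa [add_sub_cancel_left] at h2)
      obtain ⟨y₂, u₂, h₂⟩ := hQ'.exists_containing_artinSchreier hA hfx' hfα H fun hm => hc (by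
        have h2 := (commute_of_mem_center hm x).sub_left hfx
        rw [add_sub_cancel_left] at h2
        exact h2.symm)
      exact ⟨_, _, _, _, _, _, h₁, h₂, .inl rfl⟩
    · obtain ⟨y₁, z₁, h₁⟩ := hQ.exists_containing_sq hA hfx hfα H
      obtain ⟨y₂, z₂, h₂⟩ := hQ'.exists_containing_sq hA hfx' hfα H
      exact ⟨_, _, _, _, _, _, h₁, h₂, .inr rfl⟩

theorem GenQuad.exists_lambda3_path {x y z u x' y' z' u' : A} (hA : GenQuadsGenerate A)
    (hQ : GenQuad x y z u) (hQ' : GenQuad x' y' z' u') :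
    ∃ x₁ y₁ z₁ u₁ x₂ y₂ z₂ u₂, GenQuad x₁ y₁ z₁ u₁ ∧ GenQuad x₂ y₂ z₂ u₂ ∧
      Lambda3Step (x, y, z, u) (x₁, y₁, z₁, u₁) ∧
      Lambda3Step (x₁, y₁, z₁, u₁) (x₂, y₂, z₂, u₂) ∧
      Lambda3Step (x₂, y₂, z₂, u₂) (x', y', z', u') := by
  by_cases hc : Commute x x'
  · by_cases hm : x' + x ∈ Subring.center A
    · have hx' {w : A} (hw : Commute x w) : Commute x' w := by
        have := (commute_of_mem_center hm w).sub_left hw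
        rwa [add_sub_cancel_right] at this
      have hx'y : x' * y = y * x' + y := by
        have := (commute_of_mem_center hm y).eq
        rw [add_mul, mul_add, hQ.xy, add_comm (y * x), ← add_assoc] at this
        have := add_right_cancel this
        rw [← this, CharTwo.add_cancel_right]
      exact ⟨x', y, z, u, x', y', z', u', ⟨hQ.y_ne, hQ.u_ne, hx'y, hQ.zu, hx' hQ.xz,
        hx' hQ.xu, hQ.yz, hQ.yu⟩, hQ', .inl (.inr (.inl rfl)), .inl (.inl rfl), .inl (.inl rfl)⟩
    · obtain ⟨y₁, u₁, h₁⟩ := hQ.exists_containing_artinSchreier hA hc.symm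
        (fun hx' => hQ'.y_ne (by
          have := hQ'.xy
          rwa [(commute_of_mem_center hx' y').eq, left_eq_add] at this))
        (hQ'.artinSchreier_mem hA) hm
      exact ⟨x, y₁, x', u₁, x', y', z', u', h₁, hQ', .inl (.inl rfl),
        .inr (.inr (.inr (.inl rfl))), .inl (.inl rfl)⟩
  · obtain ⟨y₁, z₁, u₁, y₂, z₂, u₂, h₁, h₂, h | h⟩ := hQ.exists_linking hA hQ' hc
    · exact ⟨x, y₁, z₁, u₁, x', y₂, z₂, u₂, h₁, h₂, .inl (.inl rfl),
        .inl (.inr (.inr (.inl h))), .inl (.inl rfl)⟩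
    · exact ⟨x, y₁, z₁, u₁, x', y₂, z₂, u₂, h₁, h₂, .inl (.inl rfl),
        .inl (.inr (.inr (.inr h))), .inl (.inl rfl)⟩

end CharTwoDivisionRing

section Algebra

variable {F A : Type*} [Field F] [DivisionRing A] [Algebra F A]

/-- The subspace spanned by `M`, `M * x`, `M * y`, `M * x * y`. -/
theorem exists_submodule_finrank [FiniteDimensional F A] (M : Submodule F A) {x y : A}
    (hy : y ≠ 0) (hxy : x * y = y * x + y) (hx : ∀ m ∈ M, Commute m x)
    (hyM : ∀ m ∈ M, Commute m y) :
    ∃ N : Submodule F A, Module.finrank F N = 4 * Module.finrank F M ∧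
      ∀ w, (∀ m ∈ M, Commute m w) → Commute x w → Commute y w → ∀ n ∈ N, Commute n w := by
  let ψ : (M × M) →ₗ[F] A := M.subtype.coprod (LinearMap.mulRight F x ∘ₗ M.subtype)
  let φ : ((M × M) × (M × M)) →ₗ[F] A := ψ.coprod (LinearMap.mulRight F y ∘ₗ ψ)
  have hφ (a b c d : M) : φ ((a, b), (c, d)) = a + b * x + (c + d * x) * y := rfl
  have hinj : Function.Injective φ := by
    rw [← LinearMap.ker_eq_bot, LinearMap.ker_eq_bot']
    rintro ⟨⟨a, b⟩, ⟨c, d⟩⟩ h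
    rw [hφ] at h
    obtain ⟨h1, h2, h3, h4⟩ := eq_zero_of_decomp_eq_zero hy hxy (hx _ a.2) (hyM _ a.2)
      (hx _ b.2) (hyM _ b.2) (hx _ c.2) (hyM _ c.2) (hx _ d.2) (hyM _ d.2) h
    ext <;> assumption
  refine ⟨LinearMap.range φ, ?_, ?_⟩
  · rw [LinearMap.finrank_range_of_inj hinj]
    simp only [Module.finrank_prod]
    ring
  · rintro w hw hxw hyw _ ⟨⟨⟨a, b⟩, ⟨c, d⟩⟩, rfl⟩
    rw [hφ]
    exact ((hw _ a.2).add_left ((hw _ b.2).mul_left hxw)).add_left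
      (((hw _ c.2).add_left ((hw _ d.2).mul_left hxw)).mul_left hyw)

theorem genQuadsGenerate_of_finrank (hdim : Module.finrank F A = 16) :
    GenQuadsGenerate A := by
  have : FiniteDimensional F A := .of_finrank_pos (by omega)
  intro x y z u h w hwx hwy hwz hwu
  have hmem {v : A} : v ∈ Subalgebra.centralizer F {x, y, z, u} ↔
      Commute v x ∧ Commute v y ∧ Commute v z ∧ Commute v u := by
    simp only [Subalgebra.mem_centralizer_iff, Set.forall_mem_insert, Set.mem_singleton_iff,
      forall_eq]
    exact and_congr eq_comm (and_congr eq_comm (and_congr eq_comm eq_comm))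
  obtain ⟨C, hC⟩ : ∃ C, C = Subalgebra.centralizer F {x, y, z, u} := ⟨_, rfl⟩
  rw [← hC] at hmem
  obtain ⟨N, hN, hNc⟩ := exists_submodule_finrank (Subalgebra.toSubmodule C) h.u_ne h.zu
    (fun m hm => (hmem.1 hm).2.2.1) (fun m hm => (hmem.1 hm).2.2.2)
  obtain ⟨N', hN', -⟩ := exists_submodule_finrank N h.y_ne h.xy
    (hNc x (fun m hm => (hmem.1 hm).1) h.xz.symm h.xu.symm)
    (hNc y (fun m hm => (hmem.1 hm).2.1) h.yz.symm h.yu.symm)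
  have hle := Submodule.finrank_le N'
  have hCN : Module.finrank F (Subalgebra.toSubmodule C) = Module.finrank F C := rfl
  have hpos : 0 < Module.finrank F C := Module.finrank_pos
  have hbot : C = ⊥ := Subalgebra.eq_bot_of_finrank_one (by omega)
  have hw : w ∈ C := hmem.2 ⟨hwx, hwy, hwz, hwu⟩
  rw [hbot, Algebra.mem_bot] at hw
  obtain ⟨f, rfl⟩ := hw
  exact mem_center_of_forall_commute fun g => Algebra.commutes f g

theorem isQuadruple_iff_genQuad [CharP A 2] (hcentral : Subalgebra.center F A = ⊥)
    (hA : GenQuadsGenerate A) {x y z u : A} : IsQuadruple F (x, y, z, u) ↔ GenQuad x y z u := by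
  have hrange {v : A} (hv : v ∈ Subring.center A) : v ∈ Set.range (algebraMap F A) := by
    rw [← Algebra.mem_bot, ← hcentral, Subalgebra.mem_center_iff]
    exact Subring.mem_center_iff.1 hv
  have hrel {v w : A} : v * w + w * v = w ↔ v * w = w * v + w := by
    rw [CharTwo.add_eq_iff_eq_add, add_comm]
  constructor
  · rintro ⟨hy, hu, -, -, -, -, hxy, hxz, hxu, hyz, hyu, hzu⟩
    exact ⟨hy, hu, hrel.1 hxy, hrel.1 hzu, hxz, hxu, hyz, hyu⟩
  · intro h
    refine ⟨h.y_ne, h.u_ne, ?_, ?_, ?_, ?_, hrel.2 h.xy, h.xz, h.xu, h.yz, h.yu, hrel.2 h.zu⟩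
    · exact hrange (by rw [pow_two]; exact h.artinSchreier_mem hA)
    · exact hrange (by rw [pow_two]; exact h.sq_mem hA)
    · exact hrange (by rw [pow_two]; exact h.swap.artinSchreier_mem hA)
    · exact hrange (by rw [pow_two]; exact h.swap.sq_mem hA)

end Algebra

/-- Every two quadruples of generators of a biquaternion division algebra `A` over a field `F`
of characteristic `2` are connected by a chain of at most three steps of type `Λ₃`. -/
theorem lambda3_chain (F A : Type*) [Field F] [CharP F 2] [DivisionRing A] [Algebra F A]
    (hcentral : Subalgebra.center F A = ⊥) (hdim : Module.finrank F A = 16)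
    (hbiquat : ∃ q : A × A × A × A, IsQuadruple F q)
    (Q Q' : A × A × A × A) (hQ : IsQuadruple F Q) (hQ' : IsQuadruple F Q') :
    ∃ n ≤ 3, ∃ c : ℕ → A × A × A × A,
      c 0 = Q ∧ c n = Q' ∧ (∀ i ≤ n, IsQuadruple F (c i)) ∧
      ∀ i < n, Lambda3Step (c i) (c (i + 1)) := by
  have : CharP A 2 := charP_of_injective_algebraMap (algebraMap F A).injective 2
  have hA : GenQuadsGenerate A := genQuadsGenerate_of_finrank hdim
  obtain ⟨x, y, z, u⟩ := Q
  obtain ⟨x', y', z', u'⟩ := Q'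
  obtain ⟨x₁, y₁, z₁, u₁, x₂, y₂, z₂, u₂, h₁, h₂, s₀, s₁, s₂⟩ :=
    ((isQuadruple_iff_genQuad hcentral hA).1 hQ).exists_lambda3_path hA
      ((isQuadruple_iff_genQuad hcentral hA).1 hQ')
  rw [← isQuadruple_iff_genQuad hcentral hA] at h₁ h₂
  refine ⟨3, le_rfl, fun
    | 0 => (x, y, z, u)
    | 1 => (x₁, y₁, z₁, u₁)
    | 2 => (x₂, y₂, z₂, u₂)
    | _ => (x', y', z', u'), rfl, rfl, fun i hi => ?_, fun i hi => ?_⟩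
  · interval_cases i <;> assumption
  · interval_cases i <;> assumption
end

section
/- If two quadruples of generators Q and Q' of A are related by a step of type Λ₃, then there exists a chain Q = Q₀, Q₁, ..., Qₙ = Q' of quadruples of generators with n ≤ 5 such that each consecutive pair Qᵢ, Qᵢ₊₁ is related by a step of type Π or by a step of type Λ₂, with at most three of the steps of type Π and at most two of type Λ₂. -/
/-- In each of the two pairs, at least one entry agrees. -/
def AgreeLambda2 {A : Type*} (q r : A × A × A × A) : Prop :=
  (q.1 = r.1 ∨ q.2.1 = r.2.1) ∧ (q.2.2.1 = r.2.2.1 ∨ q.2.2.2 = r.2.2.2)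

/-- A step of type `Λ₂`: after possibly pair-swapping the target quadruple, at most one
generator is changed in each pair. -/
def Lambda2Step {A : Type*} (q q' : A × A × A × A) : Prop :=
  AgreeLambda2 q q' ∨ AgreeLambda2 q (quadSwap q')

/-- At least one of the two pairs agrees entirely. -/
def AgreePair {A : Type*} (q r : A × A × A × A) : Prop :=
  (q.1 = r.1 ∧ q.2.1 = r.2.1) ∨ (q.2.2.1 = r.2.2.1 ∧ q.2.2.2 = r.2.2.2)

/-- A step of type `Π`: after possibly pair-swapping the target quadruple, at most one pair
is changed. -/
def PiStep {A : Type*} (q q' : A × A × A × A) : Prop :=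
  AgreePair q q' ∨ AgreePair q (quadSwap q')


section CharTwoRing

variable {A : Type*} [DivisionRing A] [CharP A 2]

theorem eq_add_of_add_eq {a b c : A} (h : a + b = c) : b = a + c := by
  rw [← h, ← add_assoc, CharTwo.add_self_eq_zero, zero_add]

/-- A relation `c + d x = 0` whose coefficients commute with `y` is trivial. -/
theorem coeff_eq_zero_of_linear {x y c d : A} (hxy : x * y + y * x = y) (hy : y ≠ 0)
    (hc : c * y = y * c) (hd : d * y = y * d) (h : c + d * x = 0) : c = 0 ∧ d = 0 := by
  have h1 : d * y = 0 := by
    calc d * y = (c + d * x) * y + y * (c + d * x) := by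
          rw [add_mul, mul_add, hc, ← mul_assoc y d x, ← hd, add_add_add_comm,
            CharTwo.add_self_eq_zero, zero_add, mul_assoc, mul_assoc, ← mul_add, hxy]
      _ = 0 := by rw [h, zero_mul, mul_zero, add_zero]
  have h2 : d = 0 := (mul_eq_zero.mp h1).resolve_right hy
  subst h2
  exact ⟨by simpa using h, rfl⟩

/-- The elements `1, x, y, xy` are independent over the centralizer of `x` and `y`. -/
theorem coeff_eq_zero_of_relation {x y : A} (hxy : x * y + y * x = y) (hy : y ≠ 0)
    (c : Fin 4 → A) (hcx : ∀ i, c i * x = x * c i) (hcy : ∀ i, c i * y = y * c i)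
    (h : c 0 + c 1 * x + c 2 * y + c 3 * (x * y) = 0) : ∀ i, c i = 0 := by
  have h1 : (c 2 + c 3 * x) * y = 0 := by
    have hx3 : x * (c 3 * (x * y)) + c 3 * (x * y) * x = c 3 * (x * y) := by
      rw [← mul_assoc x, ← hcx, mul_assoc, mul_assoc, ← mul_add, mul_assoc x y x, ← mul_add, hxy]
    have hx2 : x * (c 2 * y) + c 2 * y * x = c 2 * y := by
      rw [← mul_assoc x, ← hcx, mul_assoc, mul_assoc, ← mul_add, hxy]
    have hx1 : x * (c 1 * x) + c 1 * x * x = 0 := by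
      rw [← mul_assoc x, ← hcx, CharTwo.add_self_eq_zero]
    have hx0 : x * c 0 + c 0 * x = 0 := by
      rw [← hcx, CharTwo.add_self_eq_zero]
    calc (c 2 + c 3 * x) * y = (x * c 0 + c 0 * x) + (x * (c 1 * x) + c 1 * x * x)
          + (x * (c 2 * y) + c 2 * y * x) + (x * (c 3 * (x * y)) + c 3 * (x * y) * x) := by
          rw [hx0, hx1, hx2, hx3, zero_add, zero_add, add_mul, mul_assoc]
      _ = x * (c 0 + c 1 * x + c 2 * y + c 3 * (x * y))
          + (c 0 + c 1 * x + c 2 * y + c 3 * (x * y)) * x := by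
          simp only [mul_add, add_mul]; abel
      _ = 0 := by rw [h, zero_mul, mul_zero, add_zero]
  obtain ⟨h2, h3⟩ := coeff_eq_zero_of_linear hxy hy (hcy 2) (hcy 3)
    ((mul_eq_zero.mp h1).resolve_right hy)
  obtain ⟨h0, h1⟩ := coeff_eq_zero_of_linear hxy hy (hcy 0) (hcy 1)
    (by simpa [h2, h3] using h)
  intro i
  fin_cases i <;> assumption

end CharTwoRing

section Quadruple

variable {F A : Type*} [Field F] [CharP F 2] [DivisionRing A] [Algebra F A]

/-- In a quadruple of generators, the centralizer of the first pair is spanned by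
`1, z, u, zu`. -/
theorem IsQuadruple.exists_eq_of_commute (hdim : Module.finrank F A = 16) {x y z u : A}
    (hq : IsQuadruple F (x, y, z, u)) {v : A} (hvx : v * x = x * v) (hvy : v * y = y * v) :
    ∃ a b c d : F, v = a • (1 : A) + b • z + c • u + d • (z * u) := by
  have : CharP A 2 := charP_of_injective_algebraMap (algebraMap F A).injective 2
  obtain ⟨hy, hu, -, -, -, -, hxy, hxz, hxu, hyz, hyu, hzu⟩ := hq
  have : Module.Finite F A := Module.finite_of_finrank_pos (by omega)
  let C : Subalgebra F A := Subalgebra.centralizer F {x, y}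
  have hC {a : A} : a ∈ C ↔ a * x = x * a ∧ a * y = y * a := by
    simp only [C, Subalgebra.mem_centralizer_iff, Set.mem_insert_iff, Set.mem_singleton_iff,
      forall_eq_or_imp, forall_eq]
    exact and_congr eq_comm eq_comm
  let f : (Fin 4 → C) →ₗ[F] A :=
    { toFun := fun c => c 0 + c 1 * x + c 2 * y + c 3 * (x * y)
      map_add' := fun c d => by
        simp only [Pi.add_apply, Subalgebra.coe_add, add_mul]; abel
      map_smul' := fun r c => by
        simp only [Pi.smul_apply, Subalgebra.coe_smul, smul_mul_assoc, smul_add,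
          RingHom.id_apply] }
  have hf : Function.Injective f := by
    rw [injective_iff_map_eq_zero]
    intro c hc
    ext i
    exact coeff_eq_zero_of_relation hxy hy (fun i => (c i : A)) (fun i => (hC.1 (c i).2).1)
      (fun i => (hC.1 (c i).2).2) hc i
  have hle := LinearMap.finrank_le_finrank_of_injective hf
  rw [Module.finrank_pi_fintype, hdim] at hle
  simp only [Finset.sum_const, Finset.card_univ, Fintype.card_fin, smul_eq_mul] at hle
  have hz : z ∈ C := hC.2 ⟨hxz.symm, hyz.symm⟩
  have hu' : u ∈ C := hC.2 ⟨hxu.symm, hyu.symm⟩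
  let e : Fin 4 → C := ![1, ⟨z, hz⟩, ⟨u, hu'⟩, ⟨z, hz⟩ * ⟨u, hu'⟩]
  have he (g : Fin 4 → F) : ((∑ i, g i • e i : C) : A) =
      g 0 • (1 : A) + g 1 • z + g 2 • u + g 3 • (z * u) := by
    simp [Fin.sum_univ_four, e]
  have hli : LinearIndependent F e := by
    rw [Fintype.linearIndependent_iff]
    intro g hg i
    have hg' := he g
    rw [hg] at hg'
    have := coeff_eq_zero_of_relation hzu hu (fun i => algebraMap F A (g i))
      (fun i => Algebra.commutes _ _) (fun i => Algebra.commutes _ _)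
      (by simpa [Algebra.smul_def] using hg'.symm) i
    simpa using this
  have hcard : Fintype.card (Fin 4) = Module.finrank F C :=
    le_antisymm hli.fintype_card_le_finrank (by rw [Fintype.card_fin]; omega)
  have hv : (⟨v, hC.2 ⟨hvx, hvy⟩⟩ : C) ∈ Submodule.span F (Set.range e) := by
    rw [hli.span_eq_top_of_card_eq_finrank' hcard]
    trivial
  obtain ⟨g, hg⟩ := (Submodule.mem_span_range_iff_exists_fun F).1 hv
  exact ⟨g 0, g 1, g 2, g 3, by rw [← he, hg]⟩

/-- Elements of the centralizer of the first pair are quadratic over `F`. -/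
theorem IsQuadruple.exists_sq_add_smul (hdim : Module.finrank F A = 16) {x y z u : A}
    (hq : IsQuadruple F (x, y, z, u)) {v : A} (hvx : v * x = x * v) (hvy : v * y = y * v) :
    ∃ s n : F, v * v + s • v = n • (1 : A) := by
  have : CharP A 2 := charP_of_injective_algebraMap (algebraMap F A).injective 2
  obtain ⟨a, b, c, d, rfl⟩ := hq.exists_eq_of_commute hdim hvx hvy
  obtain ⟨-, -, -, -, ⟨α, hα⟩, ⟨β, hβ⟩, -, -, -, -, -, hzu⟩ := hq
  have h2 : (2 : F) = 0 := CharTwo.two_eq_zero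
  have hz2 : z * z = z + α • (1 : A) := by
    rw [Algebra.smul_def, mul_one, hα, add_comm (z ^ 2), ← add_assoc,
      CharTwo.add_self_eq_zero, zero_add, pow_two]
  have hu2 : u * u = β • (1 : A) := by
    rw [Algebra.smul_def, mul_one, hβ, pow_two]
  have huz : u * z = z * u + u := by
    exact eq_add_of_add_eq hzu
  have e1 : z * (z * u) = z * u + α • u := by
    rw [← mul_assoc, hz2, add_mul, smul_mul_assoc, one_mul]
  have e2 : z * u * z = α • u := by
    rw [mul_assoc, huz, mul_add, e1, add_right_comm, CharTwo.add_self_eq_zero, zero_add]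
  have e3 : z * u * u = β • z := by
    rw [mul_assoc, hu2, mul_smul_comm, mul_one]
  have e4 : u * (z * u) = β • z + β • (1 : A) := by
    rw [← mul_assoc, huz, add_mul, e3, hu2]
  have e5 : z * u * (z * u) = (α * β) • (1 : A) := by
    rw [← mul_assoc, e2, smul_mul_assoc, hu2, smul_smul]
  refine ⟨b, a * a + b * b * α + c * c * β + d * d * α * β + c * d * β + a * b, ?_⟩
  simp only [mul_add, add_mul, smul_mul_assoc, mul_smul_comm, one_mul, mul_one, hz2, hu2, huz,
    e1, e2, e3, e4, e5]
  match_scalars <;> grind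

omit [CharP F 2] in
theorem IsQuadruple.swap {q : A × A × A × A} (hq : IsQuadruple F q) :
    IsQuadruple F (quadSwap q) := by
  obtain ⟨x, y, z, u⟩ := q
  obtain ⟨hy, hu, hx2, hy2, hz2, hu2, hxy, hxz, hxu, hyz, hyu, hzu⟩ := hq
  exact ⟨hu, hy, hz2, hu2, hx2, hy2, hzu, hxz.symm, hyz.symm, hxu.symm, hyu.symm, hxy⟩

/-- A non-scalar element centralizing the first pair fails to commute with some element
centralizing the first pair. -/
theorem IsQuadruple.exists_not_commute (hdim : Module.finrank F A = 16) {x y z u : A}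
    (hq : IsQuadruple F (x, y, z, u)) {w : A} (hwx : w * x = x * w) (hwy : w * y = y * w)
    (hw : w ∉ Set.range (algebraMap F A)) :
    ∃ v : A, v * x = x * v ∧ v * y = y * v ∧ w * v + v * w ≠ 0 := by
  have : CharP A 2 := charP_of_injective_algebraMap (algebraMap F A).injective 2
  obtain ⟨a, b, c, d, h⟩ := hq.exists_eq_of_commute hdim hwx hwy
  obtain ⟨-, hu, -, -, -, -, -, hxz, hxu, hyz, hyu, hzu⟩ := hq
  by_contra! hcomm
  have hwz : w * z = z * w := CharTwo.add_eq_zero.1 (hcomm z hxz.symm hyz.symm)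
  have hwu : w * u = u * w := CharTwo.add_eq_zero.1 (hcomm u hxu.symm hyu.symm)
  have key := coeff_eq_zero_of_relation hzu hu
    ![algebraMap F A a + w, algebraMap F A b, algebraMap F A c, algebraMap F A d]
    (by simp [Fin.forall_fin_succ, Algebra.commutes, add_mul, mul_add, hwz])
    (by simp [Fin.forall_fin_succ, Algebra.commutes, add_mul, mul_add, hwu])
    (by
      have : w + (a • (1 : A) + b • z + c • u + d • (z * u)) = 0 := by
        rw [← h, CharTwo.add_self_eq_zero]
      simp only [Algebra.smul_def, mul_one] at this
      simp only [Matrix.cons_val]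
      rw [← this]
      abel) 0
  exact hw ⟨a, CharTwo.add_eq_zero.1 key⟩

/-- A non-scalar Artin–Schreier element centralizing the first pair can be completed to a
quadruple. -/
theorem IsQuadruple.exists_right_of_isArtinSchreier (hdim : Module.finrank F A = 16)
    {x y z u : A} (hq : IsQuadruple F (x, y, z, u)) {w : A} (hwx : w * x = x * w)
    (hwy : w * y = y * w) (hw : w ∉ Set.range (algebraMap F A)) (hw2 : IsArtinSchreier F w) :
    ∃ t : A, IsQuadruple F (x, y, w, t) := by
  have : CharP A 2 := charP_of_injective_algebraMap (algebraMap F A).injective 2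
  obtain ⟨v, hvx, hvy, hv⟩ := hq.exists_not_commute hdim hwx hwy hw
  generalize ht : w * v + v * w = t at hv
  have htx : t * x = x * t := by
    rw [← ht]; exact ((Commute.mul_left hwx hvx).add_left (Commute.mul_left hvx hwx))
  have hty : t * y = y * t := by
    rw [← ht]; exact ((Commute.mul_left hwy hvy).add_left (Commute.mul_left hvy hwy))
  have hwt : w * t + t * w = t := by
    obtain ⟨α, hα⟩ := hw2
    have hww : w * w = w + algebraMap F A α := by
      rw [hα, pow_two]
      exact eq_add_of_add_eq (add_comm _ _)
    calc w * t + t * w = w * w * v + v * (w * w) + (w * v * w + w * v * w) := by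
          rw [← ht]; noncomm_ring
      _ = w * v + v * w + (algebraMap F A α * v + v * algebraMap F A α) := by
          rw [CharTwo.add_self_eq_zero, hww]; noncomm_ring
      _ = t := by
          rw [Algebra.commutes, CharTwo.add_self_eq_zero, add_zero, ht]
  obtain ⟨s, n, hs⟩ := hq.exists_sq_add_smul hdim htx hty
  have htw : t * w = w * t + t := eq_add_of_add_eq hwt
  have hst : s • t = 0 := by
    have h1 : w * (t * t) + t * t * w = 0 := by
      rw [mul_assoc t t w, htw, mul_add, ← mul_assoc t w t, htw, add_mul, mul_assoc w t t,
        add_assoc, CharTwo.add_self_eq_zero, add_zero, CharTwo.add_self_eq_zero]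
    calc s • t = (w * (t * t) + t * t * w) + s • (w * t + t * w) := by rw [h1, hwt, zero_add]
      _ = w * (t * t + s • t) + (t * t + s • t) * w := by
          simp only [mul_add, add_mul, mul_smul_comm, smul_mul_assoc, smul_add]; abel
      _ = 0 := by
          rw [hs, mul_smul_comm, smul_mul_assoc, one_mul, mul_one, CharTwo.add_self_eq_zero]
  obtain ⟨hy, -, hx2, hy2, -, -, hxy, -⟩ := hq
  refine ⟨t, hy, hv, hx2, hy2, hw2, ⟨n, ?_⟩, hxy, hwx.symm, htx.symm, hwy.symm, hty.symm, hwt⟩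
  rw [Algebra.algebraMap_eq_smul_one, ← hs, hst, add_zero, pow_two]

/-- A non-scalar square-central element centralizing the first pair can be completed to a
quadruple. -/
theorem IsQuadruple.exists_left_of_isSquareCentral (hdim : Module.finrank F A = 16)
    {x y z u : A} (hq : IsQuadruple F (x, y, z, u)) {w : A} (hwx : w * x = x * w)
    (hwy : w * y = y * w) (hw : w ∉ Set.range (algebraMap F A)) (hw2 : IsSquareCentral F w) :
    ∃ r : A, IsQuadruple F (x, y, r, w) := by
  have : CharP A 2 := charP_of_injective_algebraMap (algebraMap F A).injective 2
  have hw0 : w ≠ 0 := fun h => hw ⟨0, by rw [h, map_zero]⟩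
  obtain ⟨v, hvx, hvy, hv⟩ := hq.exists_not_commute hdim hwx hwy hw
  generalize ht : w * v + v * w = t at hv
  have htx : Commute t x := by
    rw [← ht]; exact ((Commute.mul_left hwx hvx).add_left (Commute.mul_left hvx hwx))
  have hty : Commute t y := by
    rw [← ht]; exact ((Commute.mul_left hwy hvy).add_left (Commute.mul_left hvy hwy))
  have htw : Commute t w := by
    obtain ⟨β, hβ⟩ := hw2
    have hc : v * (w * w) = w * w * v := by
      rw [← pow_two, ← hβ, Algebra.commutes]
    rw [← ht]
    change (w * v + v * w) * w = w * (w * v + v * w)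
    rw [add_mul, mul_add, mul_assoc v w w, hc, mul_assoc, mul_assoc, add_comm]
  generalize hr : w * t⁻¹ * v = r
  have hrx : r * x = x * r := by
    rw [← hr]
    exact (Commute.mul_left hwx htx.inv_left₀).mul_left hvx
  have hry : r * y = y * r := by
    rw [← hr]
    exact (Commute.mul_left hwy hty.inv_left₀).mul_left hvy
  have hrw : r * w + w * r = w := by
    calc r * w + w * r = w * t⁻¹ * v * w + w * (w * t⁻¹) * v := by
          rw [← hr]; simp only [mul_assoc]
      _ = w * t⁻¹ * (w * v + v * w) := by
          rw [← htw.inv_left₀.eq]; simp only [mul_add, mul_assoc]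
          rw [← mul_assoc w t⁻¹ (w * v), ← htw.inv_left₀.eq, add_comm]
          simp only [mul_assoc]
      _ = w := by rw [ht, inv_mul_cancel_right₀ hv]
  obtain ⟨s, n, hs⟩ := hq.exists_sq_add_smul hdim hrx hry
  have hwr : w * r = r * w + w := eq_add_of_add_eq hrw
  have hsw : w + s • w = 0 := by
    have h1 : r * r * w + w * (r * r) = w := by
      rw [← mul_assoc w r r, hwr, add_mul, mul_assoc r w r, hwr, mul_add, ← mul_assoc r r w,
        add_assoc, ← add_assoc, CharTwo.add_self_eq_zero, zero_add, ← add_assoc,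
        CharTwo.add_self_eq_zero, zero_add]
    calc w + s • w = (r * r * w + w * (r * r)) + s • (r * w + w * r) := by rw [h1, hrw]
      _ = w * (r * r + s • r) + (r * r + s • r) * w := by
          simp only [mul_add, add_mul, mul_smul_comm, smul_mul_assoc, smul_add]; abel
      _ = 0 := by
          rw [hs, mul_smul_comm, smul_mul_assoc, one_mul, mul_one, CharTwo.add_self_eq_zero]
  have hs1 : s = 1 := by
    have : (1 + s) • w = 0 := by rw [add_smul, one_smul, hsw]
    exact (CharTwo.add_eq_zero.1 ((smul_eq_zero.1 this).resolve_right hw0)).symm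
  obtain ⟨hy, -, hx2, hy2, -, -, hxy, -⟩ := hq
  refine ⟨r, hy, hw0, hx2, hy2, ⟨n, ?_⟩, hw2, hxy, hrx.symm, hwx.symm, hry.symm, hwy.symm, hrw⟩
  rw [Algebra.algebraMap_eq_smul_one, ← hs, hs1, one_smul, pow_two]

/-- The Artin–Schreier generators of a quadruple are not scalars. -/
theorem IsQuadruple.not_mem_range {x y z u : A} (hq : IsQuadruple F (x, y, z, u)) :
    z ∉ Set.range (algebraMap F A) := by
  have : CharP A 2 := charP_of_injective_algebraMap (algebraMap F A).injective 2
  obtain ⟨-, hu, -, -, -, -, -, -, -, -, -, hzu⟩ := hq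
  rintro ⟨a, rfl⟩
  rw [Algebra.commutes, CharTwo.add_self_eq_zero] at hzu
  exact hu hzu.symm

/-- Quadruples with the same first entry: the centralizers of their first pairs share a
non-scalar element. -/
theorem IsQuadruple.exists_common_of_fst_eq {x y y' z z' u u' : A}
    (hq : IsQuadruple F (x, y, z, u)) (hq' : IsQuadruple F (x, y', z', u')) :
    ∃ w ∉ Set.range (algebraMap F A), w * x = x * w ∧ w * y = y * w ∧ w * y' = y' * w := by
  have : CharP A 2 := charP_of_injective_algebraMap (algebraMap F A).injective 2
  have hz := hq.not_mem_range
  obtain ⟨hy, -, -, ⟨β, hβ⟩, -, -, hxy, hxz, -, hyz, -⟩ := hq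
  obtain ⟨-, -, -, ⟨β', hβ'⟩, -, -, hxy', -⟩ := hq'
  have hyx : y * x = x * y + y := eq_add_of_add_eq hxy
  have hyx' : y' * x = x * y' + y' := eq_add_of_add_eq hxy'
  have hyy : y * y = algebraMap F A β := by rw [hβ, pow_two]
  have hyy' : y' * y' = algebraMap F A β' := by rw [hβ', pow_two]
  have hyy'x : y * y' * x = x * (y * y') := by
    rw [mul_assoc, hyx', mul_add, ← mul_assoc, hyx, add_mul, add_assoc,
      CharTwo.add_self_eq_zero, add_zero, mul_assoc]
  have hy'yx : y' * y * x = x * (y' * y) := by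
    rw [mul_assoc, hyx, mul_add, ← mul_assoc, hyx', add_mul, add_assoc,
      CharTwo.add_self_eq_zero, add_zero, mul_assoc]
  by_cases h1 : y * y' + y' * y ∈ Set.range (algebraMap F A)
  · obtain ⟨f, hf⟩ := h1
    have hy'y : y' * y = y * y' + algebraMap F A f := eq_add_of_add_eq hf.symm
    by_cases h2 : algebraMap F A f * x + y * y' ∈ Set.range (algebraMap F A)
    · obtain ⟨e, he⟩ := h2
      have hyy'e : y * y' = algebraMap F A f * x + algebraMap F A e :=
        eq_add_of_add_eq he.symm
      refine ⟨z, hz, hxz.symm, hyz.symm, mul_left_cancel₀ hy ?_⟩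
      have : z * (y * y') = y * y' * z := by
        rw [hyy'e, mul_add, add_mul, ← mul_assoc, ← Algebra.commutes f z, mul_assoc, ← hxz,
          ← mul_assoc, Algebra.commutes e z]
      rw [← mul_assoc, hyz, mul_assoc, this, mul_assoc]
    · refine ⟨_, h2, ?_, ?_, ?_⟩
      · rw [add_mul, mul_add, hyy'x, ← mul_assoc x _ x, ← Algebra.commutes f x]
      · rw [add_mul, mul_add, mul_assoc y y' y, hy'y, mul_assoc, ← mul_assoc y,
          ← Algebra.commutes f y, mul_assoc _ y x, hyx]
        simp only [mul_add]
        rw [Algebra.commutes f y, add_assoc, add_comm (y * (y * y'))]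
      · rw [add_mul, mul_add, ← mul_assoc y' y y', hy'y, ← mul_assoc y', ← Algebra.commutes f y',
          mul_assoc _ y' x, hyx']
        simp only [mul_add, add_mul, mul_assoc]
        rw [add_assoc, add_comm (y * (y' * y')), ← add_assoc (algebraMap F A f * y'),
          CharTwo.add_self_eq_zero, zero_add]
  · refine ⟨_, h1, ?_, ?_, ?_⟩
    · rw [add_mul, mul_add, hyy'x, hy'yx]
    · rw [add_mul, mul_add, mul_assoc y' y y, hyy, ← Algebra.commutes, ← hyy]
      simp only [mul_assoc]
      rw [add_comm]
    · rw [add_mul, mul_add, mul_assoc y y' y', hyy', ← Algebra.commutes, ← hyy']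
      simp only [mul_assoc]
      rw [add_comm]

/-- Quadruples with the same second entry: the centralizers of their first pairs share a
non-scalar element. -/
theorem IsQuadruple.exists_common_of_snd_eq {x x' y z z' u u' : A}
    (hq : IsQuadruple F (x, y, z, u)) (hq' : IsQuadruple F (x', y, z', u')) :
    ∃ w ∉ Set.range (algebraMap F A), w * x = x * w ∧ w * x' = x' * w ∧ w * y = y * w := by
  have : CharP A 2 := charP_of_injective_algebraMap (algebraMap F A).injective 2
  have hz := hq.not_mem_range
  obtain ⟨hy, -, ⟨c, hc⟩, -, -, -, hxy, hxz, -, hyz, -⟩ := hq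
  obtain ⟨-, -, ⟨c', hc'⟩, -, -, -, hxy', -⟩ := hq'
  have hyx : x * y = y * x + y := eq_add_of_add_eq (by rw [add_comm, hxy])
  have hyx' : x' * y = y * x' + y := eq_add_of_add_eq (by rw [add_comm, hxy'])
  have hxx : x * x = x + algebraMap F A c :=
    eq_add_of_add_eq (by rw [add_comm, hc, pow_two])
  have hxx' : x' * x' = x' + algebraMap F A c' :=
    eq_add_of_add_eq (by rw [add_comm, hc', pow_two])
  generalize hk : x * x' + x' * x = k
  have hkx : k * x = x * k + k := by
    apply eq_add_of_add_eq
    calc x * k + k * x = x * x * x' + x' * (x * x) + (x * x' * x + x * x' * x) := by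
          rw [← hk]; noncomm_ring
      _ = k + (algebraMap F A c * x' + x' * algebraMap F A c) := by
          rw [CharTwo.add_self_eq_zero, hxx, ← hk]; noncomm_ring
      _ = k := by rw [Algebra.commutes, CharTwo.add_self_eq_zero, add_zero]
  have hkx' : k * x' = x' * k + k := by
    apply eq_add_of_add_eq
    calc x' * k + k * x' = x' * x' * x + x * (x' * x') + (x' * x * x' + x' * x * x') := by
          rw [← hk]; noncomm_ring
      _ = k + (algebraMap F A c' * x + x * algebraMap F A c') := by
          rw [CharTwo.add_self_eq_zero, hxx', ← hk]; noncomm_ring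
      _ = k := by rw [Algebra.commutes, CharTwo.add_self_eq_zero, add_zero]
  have hky : k * y = y * k := by
    rw [← hk]
    calc (x * x' + x' * x) * y = x * (x' * y) + x' * (x * y) := by noncomm_ring
      _ = x * (y * x' + y) + x' * (y * x + y) := by rw [hyx, hyx']
      _ = x * y * x' + x * y + (x' * y * x + x' * y) := by noncomm_ring
      _ = (y * x + y) * x' + (y * x + y) + ((y * x' + y) * x + (y * x' + y)) := by
          rw [hyx, hyx']
      _ = y * (x * x' + x' * x) + ((y * x + y * x) + (y * x' + y * x') + (y + y)) := by
          noncomm_ring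
      _ = y * (x * x' + x' * x) := by simp only [CharTwo.add_self_eq_zero, add_zero]
  by_cases h1 : x + x' + k ∈ Set.range (algebraMap F A)
  · obtain ⟨e, he⟩ := h1
    by_cases h2 : y * k ∈ Set.range (algebraMap F A)
    · obtain ⟨r, hr⟩ := h2
      have hkz : z * k = k * z := by
        apply mul_left_cancel₀ hy
        rw [← mul_assoc, hyz, mul_assoc, ← mul_assoc y, ← hr, Algebra.commutes]
      refine ⟨z, hz, hxz.symm, ?_, hyz.symm⟩
      have hx' : x' = x + (k + algebraMap F A e) := by
        apply eq_add_of_add_eq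
        rw [he, add_comm (x + x') k, ← add_assoc, CharTwo.add_self_eq_zero, zero_add]
      rw [hx']
      simp only [mul_add, add_mul, hkz, hxz, Algebra.commutes]
    · refine ⟨_, h2, ?_, ?_, ?_⟩
      · rw [mul_assoc, hkx, ← mul_assoc x, hyx, mul_add, add_mul, mul_assoc]
      · rw [mul_assoc, hkx', ← mul_assoc x', hyx', mul_add, add_mul, mul_assoc]
      · rw [mul_assoc, hky]
  · refine ⟨_, h1, ?_, ?_, ?_⟩
    · calc (x + x' + k) * x = x * x + (x * x' + k) + (x * k + k) := by
            rw [add_mul, add_mul, eq_add_of_add_eq hk, hkx]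
        _ = x * (x + x' + k) + (k + k) := by noncomm_ring
        _ = x * (x + x' + k) := by rw [CharTwo.add_self_eq_zero, add_zero]
    · calc (x + x' + k) * x' = x' * x + k + x' * x' + (x' * k + k) := by
            rw [add_mul, add_mul, eq_add_of_add_eq ((add_comm _ _).trans hk), hkx']
        _ = x' * (x + x' + k) + (k + k) := by noncomm_ring
        _ = x' * (x + x' + k) := by rw [CharTwo.add_self_eq_zero, add_zero]
    · simp only [mul_add, add_mul, hky, hyx, hyx']
      rw [add_add_add_comm, CharTwo.add_self_eq_zero, add_zero]

/-- A non-scalar element centralizing the first pair of two quadruples gives a generator which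
can be put in both. -/
theorem IsQuadruple.exists_common_right (hdim : Module.finrank F A = 16)
    {x x' y y' z z' u u' w : A} (hq : IsQuadruple F (x, y, z, u))
    (hq' : IsQuadruple F (x', y', z', u')) (hw : w ∉ Set.range (algebraMap F A))
    (hwx : w * x = x * w) (hwy : w * y = y * w) (hwx' : w * x' = x' * w)
    (hwy' : w * y' = y' * w) :
    ∃ r t r' t' : A, (r = r' ∨ t = t') ∧ IsQuadruple F (x, y, r, t) ∧
      IsQuadruple F (x', y', r', t') := by
  obtain ⟨s, n, hs⟩ := hq.exists_sq_add_smul hdim hwx hwy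
  by_cases hs0 : s = 0
  · have hw2 : IsSquareCentral F w :=
      ⟨n, by rw [Algebra.algebraMap_eq_smul_one, ← hs, hs0, zero_smul, add_zero, pow_two]⟩
    obtain ⟨r, hr⟩ := hq.exists_left_of_isSquareCentral hdim hwx hwy hw hw2
    obtain ⟨r', hr'⟩ := hq'.exists_left_of_isSquareCentral hdim hwx' hwy' hw hw2
    exact ⟨r, w, r', w, .inr rfl, hr, hr'⟩
  · have hv2 : IsArtinSchreier F (s⁻¹ • w) := by
      refine ⟨s⁻¹ * s⁻¹ * n, ?_⟩
      rw [Algebra.algebraMap_eq_smul_one, mul_smul, ← hs, smul_add, smul_smul, mul_assoc,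
        inv_mul_cancel₀ hs0, mul_one, pow_two, smul_mul_smul_comm]
    have hv : s⁻¹ • w ∉ Set.range (algebraMap F A) := by
      rintro ⟨a, ha⟩
      exact hw ⟨s * a, by rw [map_mul, ha, ← Algebra.smul_def, smul_inv_smul₀ hs0]⟩
    have hcomm {a : A} (ha : w * a = a * w) : s⁻¹ • w * a = a * s⁻¹ • w := by
      rw [smul_mul_assoc, mul_smul_comm, ha]
    obtain ⟨t, ht⟩ :=
      hq.exists_right_of_isArtinSchreier hdim (hcomm hwx) (hcomm hwy) hv hv2
    obtain ⟨t', ht'⟩ :=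
      hq'.exists_right_of_isArtinSchreier hdim (hcomm hwx') (hcomm hwy') hv hv2
    exact ⟨_, t, _, t', .inl rfl, ht, ht'⟩

/-- Two quadruples sharing a generator of the first pair are connected by changing the second
pair, then at most one generator in each pair, then the second pair again. -/
theorem IsQuadruple.exists_chain (hdim : Module.finrank F A = 16) {q q' : A × A × A × A}
    (hq : IsQuadruple F q) (hq' : IsQuadruple F q') (h : q.1 = q'.1 ∨ q.2.1 = q'.2.1) :
    ∃ r s, AgreePair q r ∧ AgreeLambda2 r s ∧ AgreePair s q' ∧
      IsQuadruple F r ∧ IsQuadruple F s := by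
  obtain ⟨x, y, z, u⟩ := q
  obtain ⟨x', y', z', u'⟩ := q'
  obtain ⟨w, hw, hwx, hwy, hwx', hwy'⟩ : ∃ w ∉ Set.range (algebraMap F A),
      w * x = x * w ∧ w * y = y * w ∧ w * x' = x' * w ∧ w * y' = y' * w := by
    rcases h with h | h
    · obtain rfl : x = x' := h
      obtain ⟨w, hw, h1, h2, h3⟩ := hq.exists_common_of_fst_eq hq'
      exact ⟨w, hw, h1, h2, h1, h3⟩
    · obtain rfl : y = y' := h
      obtain ⟨w, hw, h1, h2, h3⟩ := hq.exists_common_of_snd_eq hq'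
      exact ⟨w, hw, h1, h3, h2, h3⟩
  obtain ⟨r, t, r', t', hrt, hr, hr'⟩ :=
    hq.exists_common_right hdim hq' hw hwx hwy hwx' hwy'
  exact ⟨(x, y, r, t), (x', y', r', t'), .inl ⟨rfl, rfl⟩, ⟨h, hrt⟩, .inl ⟨rfl, rfl⟩, hr, hr'⟩

end Quadruple

/-- Every step of type `Λ₃` between quadruples of generators can be achieved by a chain of at
most five steps, at most three of which are of type `Π` and at most two of type `Λ₂`. -/
theorem lambda3_eq_pi_lambda2 (F A : Type*) [Field F] [CharP F 2] [DivisionRing A] [Algebra F A]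
    (hcentral : Subalgebra.center F A = ⊥) (hdim : Module.finrank F A = 16)
    (hbiquat : ∃ q : A × A × A × A, IsQuadruple F q)
    (Q Q' : A × A × A × A) (hQ : IsQuadruple F Q) (hQ' : IsQuadruple F Q')
    (hstep : Lambda3Step Q Q') :
    ∃ n ≤ 5, ∃ c : ℕ → A × A × A × A, ∃ t : ℕ → Bool,
      c 0 = Q ∧ c n = Q' ∧ (∀ i ≤ n, IsQuadruple F (c i)) ∧
      (∀ i < n, if t i then PiStep (c i) (c (i + 1)) else Lambda2Step (c i) (c (i + 1))) ∧
      ((Finset.range n).filter fun i => t i = true).card ≤ 3 ∧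
      ((Finset.range n).filter fun i => t i = false).card ≤ 2 := by
  obtain ⟨R, S, h1, h2, h3, hR, hS⟩ :
      ∃ R S, PiStep Q R ∧ Lambda2Step R S ∧ PiStep S Q' ∧ IsQuadruple F R ∧ IsQuadruple F S := by
    rcases hstep with (h | h | h | h) | (h | h | h | h)
    · obtain ⟨R, S, h1, h2, h3, hR, hS⟩ := hQ.exists_chain hdim hQ' (.inl h)
      exact ⟨R, S, .inl h1, .inl h2, .inl h3, hR, hS⟩
    · obtain ⟨R, S, h1, h2, h3, hR, hS⟩ := hQ.exists_chain hdim hQ' (.inr h)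
      exact ⟨R, S, .inl h1, .inl h2, .inl h3, hR, hS⟩
    · obtain ⟨R, S, h1, h2, h3, hR, hS⟩ := hQ.swap.exists_chain hdim hQ'.swap (.inl h)
      exact ⟨quadSwap R, quadSwap S, .inl (Or.symm h1), .inl (And.symm h2), .inl (Or.symm h3), hR.swap, hS.swap⟩
    · obtain ⟨R, S, h1, h2, h3, hR, hS⟩ := hQ.swap.exists_chain hdim hQ'.swap (.inr h)
      exact ⟨quadSwap R, quadSwap S, .inl (Or.symm h1), .inl (And.symm h2), .inl (Or.symm h3), hR.swap, hS.swap⟩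
    · obtain ⟨R, S, h1, h2, h3, hR, hS⟩ := hQ.exists_chain hdim hQ'.swap (.inl h)
      exact ⟨R, S, .inl h1, .inl h2, .inr h3, hR, hS⟩
    · obtain ⟨R, S, h1, h2, h3, hR, hS⟩ := hQ.exists_chain hdim hQ'.swap (.inr h)
      exact ⟨R, S, .inl h1, .inl h2, .inr h3, hR, hS⟩
    · obtain ⟨R, S, h1, h2, h3, hR, hS⟩ := hQ.swap.exists_chain hdim hQ' (.inl h)
      exact ⟨quadSwap R, quadSwap S, .inl (Or.symm h1), .inl (And.symm h2), .inr (Or.symm h3), hR.swap, hS.swap⟩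
    · obtain ⟨R, S, h1, h2, h3, hR, hS⟩ := hQ.swap.exists_chain hdim hQ' (.inr h)
      exact ⟨quadSwap R, quadSwap S, .inl (Or.symm h1), .inl (And.symm h2), .inr (Or.symm h3), hR.swap, hS.swap⟩
  refine ⟨3, by norm_num, fun i => match i with | 0 => Q | 1 => R | 2 => S | _ => Q',
    fun i => decide (i ≠ 1), rfl, rfl, ?_, ?_, by decide, by decide⟩
  · intro i hi
    interval_cases i <;> assumption
  · intro i hi
    interval_cases i
    · exact h1
    · exact h2
    · exact h3
end

section
/- For any two quadruples of generators Q and Q' of A, there exists a chain Q = Q₀, Q₁, ..., Qₙ = Q' of quadruples of generators with n ≤ 15 such that each consecutive pair Qᵢ, Qᵢ₊₁ is related by a step of type Π or by a step of type Λ₂, with at most 9 of the steps of type Π and at most 6 of type Λ₂. -/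
/-- `x` and `y` generate a quaternion algebra: `x² + x ∈ F·1`, `0 ≠ y`, `y² ∈ F·1` and
`xy + yx = y`. -/
def IsPair (F : Type*) {A : Type*} [Field F] [Ring A] [Algebra F A] (x y : A) : Prop :=
  y ≠ 0 ∧ IsArtinSchreier F x ∧ IsSquareCentral F y ∧ x * y + y * x = y

theorem isQuadruple_iff {F A : Type*} [Field F] [Ring A] [Algebra F A] {x y z u : A} :
    IsQuadruple F (x, y, z, u) ↔ IsPair F x y ∧ IsPair F z u ∧
      Commute x z ∧ Commute x u ∧ Commute y z ∧ Commute y u := by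
  simp only [IsQuadruple, IsPair, commute_iff_eq]
  tauto

section Centralizers

variable {F A : Type*} [Field F] [DivisionRing A] [Algebra F A]

theorem mem_range_of_forall_commute (hc : Subalgebra.center F A = ⊥) {b : A}
    (h : ∀ a, Commute a b) : b ∈ Set.range (algebraMap F A) := by
  have hb : b ∈ Subalgebra.center F A := Subalgebra.mem_center_iff.2 fun a => h a
  rwa [hc, Algebra.mem_bot] at hb

theorem commute_of_mem_range {b : A} (h : b ∈ Set.range (algebraMap F A)) (a : A) :
    Commute b a := by
  obtain ⟨r, rfl⟩ := h
  exact Algebra.commutes r a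

/-- Adjoining to `S` an element that does not commute with the whole centralizer of `S` at least
halves the dimension of the centralizer. -/
theorem two_mul_finrank_centralizer_insert_le [FiniteDimensional F A] {S : Set A} {b q : A}
    (hq : ∀ s ∈ S, Commute s q) (hqb : ¬ Commute b q) :
    2 * Module.finrank F (Subalgebra.centralizer F (insert b S)) ≤
      Module.finrank F (Subalgebra.centralizer F S) := by
  have hq0 : q ≠ 0 := by
    rintro rfl
    exact hqb (Commute.zero_right b)
  set W := Subalgebra.toSubmodule (Subalgebra.centralizer F (insert b S)) with hW
  set V := Subalgebra.toSubmodule (Subalgebra.centralizer F S) with hV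
  have hmemW : ∀ c, c ∈ W ↔ Commute b c ∧ ∀ s ∈ S, Commute s c := by
    intro c
    simp [hW, Subalgebra.mem_centralizer_iff, commute_iff_eq]
  have hmemV : ∀ c, c ∈ V ↔ ∀ s ∈ S, Commute s c := by
    intro c
    simp [hV, Subalgebra.mem_centralizer_iff, commute_iff_eq]
  have hinj : Function.Injective (LinearMap.mulRight F q) := mul_left_injective₀ hq0
  have hdisj : W ⊓ W.map (LinearMap.mulRight F q) = ⊥ := by
    rw [eq_bot_iff]
    rintro c ⟨hc, d, hd, rfl⟩
    rw [SetLike.mem_coe, hmemW] at hc hd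
    simp only [LinearMap.mulRight_apply, Submodule.mem_bot] at hc ⊢
    by_contra h
    have hd0 : d ≠ 0 := left_ne_zero_of_mul h
    apply hqb
    have h1 := (Commute.inv_right₀ hd.1).mul_right hc.1
    rwa [inv_mul_cancel_left₀ hd0] at h1
  have hle : W ⊔ W.map (LinearMap.mulRight F q) ≤ V := by
    refine sup_le (fun c hc => (hmemV c).2 ((hmemW c).1 hc).2) ?_
    rintro _ ⟨d, hd, rfl⟩
    exact (hmemV _).2 fun s hs => (((hmemW d).1 hd).2 s hs).mul_right (hq s hs)
  have h1 := Submodule.finrank_sup_add_finrank_inf_eq W (W.map (LinearMap.mulRight F q))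
  rw [hdisj, finrank_bot, ← (Submodule.equivMapOfInjective _ hinj W).finrank_eq] at h1
  have h2 := Submodule.finrank_mono hle
  change 2 * Module.finrank F W ≤ Module.finrank F V
  lia

/-- A non-scalar element of a centralizer of dimension at most two is quadratic. -/
theorem exists_quadratic_of_finrank_centralizer_le [FiniteDimensional F A] {S : Set A} {b : A}
    (hS : Module.finrank F (Subalgebra.centralizer F S) ≤ 2) (hb : ∀ s ∈ S, Commute s b)
    (hbF : b ∉ Set.range (algebraMap F A)) :
    ∃ t n : F, b ^ 2 = algebraMap F A t * b + algebraMap F A n := by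
  have hbS : b ∈ Subalgebra.centralizer F S :=
    (Subalgebra.mem_centralizer_iff F).2 fun s hs => hb s hs
  have hli : LinearIndependent F ![(1 : A), b] := by
    rw [LinearIndependent.pair_iff]
    intro s t hst
    have ht : t = 0 := by
      by_contra ht
      apply hbF
      refine ⟨-(t⁻¹ * s), ?_⟩
      have h1 : t • b = -(s • (1 : A)) := eq_neg_of_add_eq_zero_right hst
      have h2 : b = t⁻¹ • t • b := (inv_smul_smul₀ ht b).symm
      rw [h2, h1, Algebra.algebraMap_eq_smul_one, smul_neg, neg_smul, mul_smul]
    subst ht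
    refine ⟨?_, rfl⟩
    simpa using hst
  have hspan : Submodule.span F (Set.range ![(1 : A), b]) =
      Subalgebra.toSubmodule (Subalgebra.centralizer F S) := by
    apply Submodule.eq_of_le_of_finrank_le
    · rw [Submodule.span_le]
      rintro _ ⟨i, rfl⟩
      fin_cases i
      · exact one_mem (Subalgebra.centralizer F S)
      · exact hbS
    · rw [finrank_span_eq_card hli]
      exact hS
  have h2 : b ^ 2 ∈ Submodule.span F (Set.range ![(1 : A), b]) := by
    rw [hspan]
    exact pow_mem hbS 2
  rw [Matrix.range_cons, Matrix.range_cons, Matrix.range_empty, Set.union_empty,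
    Set.singleton_union, Submodule.mem_span_pair] at h2
  obtain ⟨n, t, h⟩ := h2
  exact ⟨t, n, by rw [← h, Algebra.algebraMap_eq_smul_one, smul_mul_assoc, one_mul,
    Algebra.algebraMap_eq_smul_one, add_comm]⟩

end Centralizers

section CharTwo

variable {F A : Type*} [Field F] [CharP F 2] [DivisionRing A] [Algebra F A]

/-- The subfield generated by a quadratic element contains a non-scalar Artin–Schreier or
square-central element. -/
theorem exists_artinSchreier_or_squareCentral {b : A} {t n : F}
    (hbF : b ∉ Set.range (algebraMap F A))
    (hb : b ^ 2 = algebraMap F A t * b + algebraMap F A n) :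
    ∃ w ∉ Set.range (algebraMap F A), (IsArtinSchreier F w ∨ IsSquareCentral F w) ∧
      ∀ a, Commute a b → Commute a w := by
  have : CharP A 2 := charP_of_injective_algebraMap (algebraMap F A).injective 2
  by_cases ht : t = 0
  · subst ht
    exact ⟨b, hbF, Or.inr ⟨n, by simp [hb]⟩, fun a h => h⟩
  · have ht' : algebraMap F A t⁻¹ * algebraMap F A t = 1 := by
      rw [← map_mul, inv_mul_cancel₀ ht, map_one]
    refine ⟨algebraMap F A t⁻¹ * b, ?_, Or.inl ⟨t⁻¹ ^ 2 * n, ?_⟩,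
      fun a h => Commute.mul_right (Algebra.commutes t⁻¹ a).symm h⟩
    · rintro ⟨r, hr⟩
      refine hbF ⟨t * r, ?_⟩
      rw [map_mul, hr, ← mul_assoc, ← map_mul, mul_inv_cancel₀ ht, map_one, one_mul]
    · have h1 := Algebra.commutes t⁻¹ b
      have h2 := Algebra.commutes t⁻¹ (algebraMap F A t)
      rw [map_mul, map_pow]
      generalize algebraMap F A t⁻¹ = s at *
      generalize algebraMap F A t = t at *
      generalize algebraMap F A n = n at *
      linear_combination (norm := grind) - s * s * hb - s * ht' * b + s * h1 * b

namespace IsPair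

variable {x y : A}

omit [CharP F 2] in
theorem mul_inv_add (h : IsPair F x y) : x * y⁻¹ + y⁻¹ * x = y⁻¹ := by
  obtain ⟨hy, -, -, hxy⟩ := h
  have h1 := mul_inv_cancel₀ hy
  have h2 := inv_mul_cancel₀ hy
  linear_combination (norm := noncomm_ring) y⁻¹ * hxy * y⁻¹ - y⁻¹ * x * h1 - h2 * x * y⁻¹
    + h2 * y⁻¹

theorem not_commute (h : IsPair F x y) : ¬ Commute x y := by
  have : CharP A 2 := charP_of_injective_algebraMap (algebraMap F A).injective 2
  intro hc
  apply h.1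
  rw [← h.2.2.2, hc.eq, CharTwo.add_self_eq_zero]

theorem left_notMem (h : IsPair F x y) : x ∉ Set.range (algebraMap F A) :=
  fun hx => h.not_commute (commute_of_mem_range hx y)

theorem commute_mul_inv {v : A} (h : IsPair F x y) (hv : x * v + v * x = v) :
    Commute x (v * y⁻¹) := by
  have : CharP A 2 := charP_of_injective_algebraMap (algebraMap F A).injective 2
  have h1 := h.mul_inv_add
  rw [commute_iff_eq]
  linear_combination (norm := grind) hv * y⁻¹ + v * h1

theorem add_self_of_commutator (h : IsPair F x y) (a : A) :
    x * (x * a + a * x) + (x * a + a * x) * x = x * a + a * x := by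
  have : CharP A 2 := charP_of_injective_algebraMap (algebraMap F A).injective 2
  obtain ⟨-, ⟨α, hα⟩, -, -⟩ := h
  have h1 := Algebra.commutes α a
  linear_combination (norm := grind) h1 - hα * a + a * hα

theorem exists_eq_add_mul_right (h : IsPair F x y) (a : A) :
    ∃ d e, Commute x d ∧ Commute x e ∧ a = d + e * y := by
  have : CharP A 2 := charP_of_injective_algebraMap (algebraMap F A).injective 2
  have hv := h.add_self_of_commutator a
  refine ⟨a + (x * a + a * x), (x * a + a * x) * y⁻¹, ?_, h.commute_mul_inv hv, ?_⟩
  · rw [commute_iff_eq]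
    linear_combination (norm := grind) hv
  · rw [inv_mul_cancel_right₀ h.1]
    grind

theorem exists_eq_add_left_mul {c : A} (h : IsPair F x y) (hc : Commute x c) :
    ∃ d e, (Commute x d ∧ Commute y d) ∧ (Commute x e ∧ Commute y e) ∧ c = d + x * e ∧
      e = c + y * c * y⁻¹ := by
  have : CharP A 2 := charP_of_injective_algebraMap (algebraMap F A).injective 2
  have h1 := h.mul_inv_add
  obtain ⟨hy, -, ⟨β, hβ⟩, hxy⟩ := h
  have h2 := Algebra.commutes β c
  have h3 := mul_inv_cancel₀ hy
  have h4 := inv_mul_cancel₀ hy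
  have hcx := hc.eq
  have hex : x * (c + y * c * y⁻¹) = (c + y * c * y⁻¹) * x := by
    linear_combination (norm := grind) hcx + hxy * c * y⁻¹ - y * hcx * y⁻¹ - y * c * h1
  have hey : y * (c + y * c * y⁻¹) = (c + y * c * y⁻¹) * y := by
    linear_combination (norm := grind) h2 * y⁻¹ - hβ * c * y⁻¹ + c * hβ * y⁻¹ + c * y * h3
      - y * c * h4
  refine ⟨c + x * (c + y * c * y⁻¹), c + y * c * y⁻¹, ⟨?_, ?_⟩, ⟨hex, hey⟩, ?_, rfl⟩
  · rw [commute_iff_eq]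
    linear_combination (norm := grind) hcx + x * hex
  · rw [commute_iff_eq]
    linear_combination (norm := grind) hxy * (c + y * c * y⁻¹) + x * hey + hey
      + y * c * h4
  · grind

end IsPair

section Biquaternion

variable (hc : Subalgebra.center F A = ⊥) {x y : A}

include hc

/-- The centralizer of a quaternion subalgebra has trivial center. -/
theorem IsPair.exists_not_commute (h : IsPair F x y) {b : A} (hxb : Commute x b)
    (hyb : Commute y b) (hbF : b ∉ Set.range (algebraMap F A)) :
    ∃ q, Commute x q ∧ Commute y q ∧ ¬ Commute b q := by
  by_contra! hcon
  apply hbF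
  refine mem_range_of_forall_commute hc fun a => ?_
  have key : ∀ c, Commute x c → Commute c b := by
    intro c hxc
    obtain ⟨d, e, hd, he, rfl, -⟩ := h.exists_eq_add_left_mul hxc
    exact (hcon d hd.1 hd.2).symm.add_left (hxb.mul_left (hcon e he.1 he.2).symm)
  obtain ⟨d, e, hd, he, rfl⟩ := h.exists_eq_add_mul_right a
  exact (key d hd).add_left ((key e he).mul_left hyb)

variable (hd : Module.finrank F A = 16)

include hd

omit hc in
/-- The centralizer of a quaternion subalgebra has dimension at most four. -/
theorem IsPair.finrank_centralizer_le (h : IsPair F x y) :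
    Module.finrank F (Subalgebra.centralizer F {y, x}) ≤ 4 := by
  have : FiniteDimensional F A := FiniteDimensional.of_finrank_pos (by lia)
  have h1 := two_mul_finrank_centralizer_insert_le (F := F) (S := ∅) (b := x) (q := y)
    (by simp) h.not_commute
  have h2 := two_mul_finrank_centralizer_insert_le (F := F) (S := {x}) (b := y) (q := x)
    (by simp) (fun hyx => h.not_commute hyx.symm)
  have h3 := Submodule.finrank_le (Subalgebra.toSubmodule (Subalgebra.centralizer F (∅ : Set A)))
  rw [Subalgebra.finrank_toSubmodule] at h3
  rw [insert_empty_eq] at h1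
  lia

/-- Every non-scalar element of the centralizer of a quaternion subalgebra is quadratic. -/
theorem IsPair.exists_quadratic (h : IsPair F x y) {b : A} (hxb : Commute x b)
    (hyb : Commute y b) (hbF : b ∉ Set.range (algebraMap F A)) :
    ∃ t n : F, b ^ 2 = algebraMap F A t * b + algebraMap F A n := by
  have : FiniteDimensional F A := FiniteDimensional.of_finrank_pos (by lia)
  obtain ⟨q, hxq, hyq, hbq⟩ := h.exists_not_commute hc hxb hyb hbF
  have h1 := two_mul_finrank_centralizer_insert_le (F := F) (S := {y, x}) (b := b) (q := q)
    (by simp [hxq, hyq]) hbq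
  have h2 := h.finrank_centralizer_le hd
  exact exists_quadratic_of_finrank_centralizer_le (S := {b, y, x}) (by lia)
    (by simp [hxb, hyb]) hbF

theorem IsPair.sq_mem_range (h : IsPair F x y) {s g : A} (hxs : Commute x s)
    (hys : Commute y s) (hg : g * s ^ 2 = s ^ 2 * g) (hgs : ¬ Commute g s) :
    IsSquareCentral F s := by
  have hsF : s ∉ Set.range (algebraMap F A) := fun hs => hgs (commute_of_mem_range hs g).symm
  obtain ⟨t, n, hs⟩ := h.exists_quadratic hc hd hxs hys hsF
  have ht : t = 0 := by
    by_contra ht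
    apply hgs
    have h1 : algebraMap F A t⁻¹ * algebraMap F A t = 1 := by
      rw [← map_mul, inv_mul_cancel₀ ht, map_one]
    have h2 := Algebra.commutes t g
    have h3 := Algebra.commutes n g
    have h4 : algebraMap F A t * (g * s) = algebraMap F A t * (s * g) := by
      linear_combination (norm := noncomm_ring) hg - g * hs + hs * g + h2 * s + h3
    have ht' : algebraMap F A t ≠ 0 := by simpa using ht
    exact mul_left_cancel₀ ht' h4
  subst ht
  exact ⟨n, by simp [hs]⟩

theorem IsPair.exists_isPair_left (h : IsPair F x y) {w : A} (hxw : Commute x w)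
    (hyw : Commute y w) (hwF : w ∉ Set.range (algebraMap F A)) (hw : IsArtinSchreier F w) :
    ∃ u, IsPair F w u ∧ Commute x u ∧ Commute y u := by
  have : CharP A 2 := charP_of_injective_algebraMap (algebraMap F A).injective 2
  obtain ⟨q, hxq, hyq, hwq⟩ := h.exists_not_commute hc hxw hyw hwF
  have hxu : Commute x (w * q + q * w) := (hxw.mul_right hxq).add_right (hxq.mul_right hxw)
  have hyu : Commute y (w * q + q * w) := (hyw.mul_right hyq).add_right (hyq.mul_right hyw)
  have hu0 : w * q + q * w ≠ 0 := fun h0 => hwq (CharTwo.add_eq_zero.1 h0)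
  have hwu : w * (w * q + q * w) + (w * q + q * w) * w = w * q + q * w := by
    obtain ⟨γ, hγ⟩ := hw
    have h1 := Algebra.commutes γ q
    linear_combination (norm := grind) h1 - hγ * q + q * hγ
  refine ⟨w * q + q * w, ⟨hu0, hw, ?_, hwu⟩, hxu, hyu⟩
  generalize w * q + q * w = u at *
  refine h.sq_mem_range hc hd hxu hyu (g := w) ?_ fun hcm => hu0 ?_
  · linear_combination (norm := grind) hwu * u + u * hwu
  · rw [← hwu, hcm.eq, CharTwo.add_self_eq_zero]

theorem IsPair.exists_isPair_right (h : IsPair F x y) {w : A} (hxw : Commute x w)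
    (hyw : Commute y w) (hwF : w ∉ Set.range (algebraMap F A)) (hw : IsSquareCentral F w) :
    ∃ z, IsPair F z w ∧ Commute x z ∧ Commute y z := by
  have : CharP A 2 := charP_of_injective_algebraMap (algebraMap F A).injective 2
  obtain ⟨q, hxq, hyq, hwq⟩ := h.exists_not_commute hc hxw hyw hwF
  have hv0 : w * q + q * w ≠ 0 := fun h0 => hwq (CharTwo.add_eq_zero.1 h0)
  have hwv : Commute w (w * q + q * w) := by
    obtain ⟨γ, hγ⟩ := hw
    have h1 := Algebra.commutes γ q
    rw [commute_iff_eq]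
    linear_combination (norm := grind) h1 - hγ * q + q * hγ
  have hxv : Commute x (w * q + q * w) := (hxw.mul_right hxq).add_right (hxq.mul_right hxw)
  have hyv : Commute y (w * q + q * w) := (hyw.mul_right hyq).add_right (hyq.mul_right hyw)
  have hw0 : w ≠ 0 := by
    rintro rfl
    exact hwF ⟨0, map_zero _⟩
  obtain ⟨z, hxz, hyz, hzw⟩ : ∃ z, Commute x z ∧ Commute y z ∧ z * w + w * z = w := by
    refine ⟨q * (w * q + q * w)⁻¹ * w, (hxq.mul_right hxv.inv_right₀).mul_right hxw,
      (hyq.mul_right hyv.inv_right₀).mul_right hyw, ?_⟩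
    have h1 := mul_inv_cancel₀ hv0
    have h2 := hwv.inv_right₀.eq
    generalize (w * q + q * w)⁻¹ = i at *
    linear_combination (norm := grind) h1 * w - q * h2 * w
  have hcm : ¬ Commute z w := by
    intro hcm
    apply hw0
    rw [← hzw, hcm.eq, CharTwo.add_self_eq_zero]
  have hzF : z ∉ Set.range (algebraMap F A) := fun hz => hcm (commute_of_mem_range hz w)
  obtain ⟨t, n, hz⟩ := h.exists_quadratic hc hd hxz hyz hzF
  refine ⟨z, ⟨hw0, ⟨n, ?_⟩, hw, hzw⟩, hxz, hyz⟩
  have ht : algebraMap F A t * w = 1 * w := by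
    have h1 := Algebra.commutes n w
    have h2 := Algebra.commutes t w
    linear_combination (norm := grind) hz * w + w * hz + z * hzw + hzw * z + hzw
      + algebraMap F A t * hzw + h1 + h2 * z
  have ht' := mul_right_cancel₀ hw0 ht
  rw [hz, ht']
  grind

theorem IsPair.of_commute_right (h : IsPair F x y) {y' w : A} (hy' : y' ≠ 0)
    (hxy' : x * y' + y' * x = y') (hyy' : Commute y y') (hwy' : Commute w y')
    (hwy : ¬ Commute w y) : IsPair F x y' := by
  refine ⟨hy', h.2.1, ?_, hxy'⟩
  have hs := h.commute_mul_inv hxy'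
  have hys : Commute y (y' * y⁻¹) := hyy'.mul_right (Commute.refl y).inv_right₀
  have hsy : y' * y⁻¹ * y = y' := inv_mul_cancel_right₀ h.1 y'
  have hs0 : y' * y⁻¹ ≠ 0 := mul_ne_zero hy' (inv_ne_zero h.1)
  obtain ⟨β, hβ⟩ := h.2.2.1
  generalize y' * y⁻¹ = s at *
  have hyse := hys.eq
  have hsq : y' ^ 2 = s ^ 2 * algebraMap F A β := by
    rw [hβ, ← hsy]
    linear_combination (norm := noncomm_ring) s * hyse * y
  have hβ0 : algebraMap F A β ≠ 0 := hβ ▸ pow_ne_zero 2 h.1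
  have hws : w * s ^ 2 = s ^ 2 * w := by
    apply mul_right_cancel₀ hβ0
    have h1 := (hwy'.pow_right 2).eq
    have h2 := Algebra.commutes β w
    linear_combination (norm := noncomm_ring) h1 - w * hsq + hsq * w + s ^ 2 * h2
  obtain ⟨δ, hδ⟩ := h.sq_mem_range hc hd hs hys hws fun hcm => hwy <| by
    have h1 := hcm.inv_right₀.mul_right hwy'
    rwa [← hsy, inv_mul_cancel_left₀ hs0] at h1
  exact ⟨δ * β, by rw [map_mul, hδ, hsq]⟩

/-- An Artin–Schreier generator `x` and an Artin–Schreier element `w` that commutes with it occur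
in a common quadruple. -/
theorem IsPair.exists_isQuadruple_of_isArtinSchreier (h : IsPair F x y) {w : A}
    (hxw : Commute x w) (hwF : w ∉ Set.range (algebraMap F A))
    (hxwF : x + w ∉ Set.range (algebraMap F A)) (hw : IsArtinSchreier F w) :
    ∃ y' u, IsQuadruple F (x, y', w, u) := by
  have : CharP A 2 := charP_of_injective_algebraMap (algebraMap F A).injective 2
  have hxwe := hxw.eq
  suffices ∃ y', IsPair F x y' ∧ Commute y' w by
    obtain ⟨y', hy', hyw⟩ := this
    obtain ⟨u, hu, hxu, hyu⟩ := hy'.exists_isPair_left hc hd hxw hyw hwF hw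
    exact ⟨y', u, isQuadruple_iff.2 ⟨hy', hu, hxw, hxu, hyw, hyu⟩⟩
  by_cases hwy : Commute w y
  · exact ⟨y, h, hwy.symm⟩
  have hxy := h.2.2.2
  by_cases hy0 : y + w * y + y * w = 0
  · have hy : Commute y (x + w) := by
      rw [commute_iff_eq]
      linear_combination (norm := grind) hxy + hy0
    have hAS : IsArtinSchreier F (x + w) := by
      obtain ⟨α, hα⟩ := h.2.1
      obtain ⟨γ, hγ⟩ := hw
      refine ⟨α + γ, ?_⟩
      rw [map_add]
      linear_combination (norm := grind) hα + hγ + hxwe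
    obtain ⟨u, ⟨hu0, -, ⟨δ, hδ⟩, hwu⟩, hxu, hyu⟩ := h.exists_isPair_left hc hd
      ((Commute.refl x).add_right hxw) hy hxwF hAS
    obtain ⟨β, hβ⟩ := h.2.2.1
    have hxue := hxu.eq
    have hyue := hyu.eq
    refine ⟨u * y, ⟨mul_ne_zero hu0 h.1, h.2.1, ⟨δ * β, ?_⟩, ?_⟩, ?_⟩
    · rw [map_mul]
      linear_combination (norm := grind) hδ * algebraMap F A β + u * u * hβ - u * hyue * y
    · linear_combination (norm := grind) hxue * y + u * hxy
    · rw [commute_iff_eq]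
      have hye := hy.eq
      linear_combination (norm := grind) hwu * y + u * hye + u * hxy - hxue * y
  · have hyw : Commute (y + w * y + y * w) w := by
      obtain ⟨γ, hγ⟩ := hw
      have h1 := Algebra.commutes γ y
      rw [commute_iff_eq]
      linear_combination (norm := grind) hγ * y - y * hγ - h1
    refine ⟨y + w * y + y * w, h.of_commute_right hc hd hy0 ?_ ?_ hyw.symm hwy, hyw⟩
    · linear_combination (norm := grind) hxy + w * hxy + hxy * w + hxwe * y + y * hxwe
    · obtain ⟨β, hβ⟩ := h.2.2.1
      have h1 := Algebra.commutes β w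
      rw [commute_iff_eq]
      linear_combination (norm := grind) h1 - hβ * w + w * hβ

/-- An Artin–Schreier generator `x` and a square-central element `w` that commutes with it occur
in a common quadruple. -/
theorem IsPair.exists_isQuadruple_of_isSquareCentral (h : IsPair F x y) {w : A}
    (hxw : Commute x w) (hwF : w ∉ Set.range (algebraMap F A)) (hw : IsSquareCentral F w) :
    ∃ y' z, IsQuadruple F (x, y', z, w) := by
  have : CharP A 2 := charP_of_injective_algebraMap (algebraMap F A).injective 2
  have hxwe := hxw.eq
  suffices ∃ y', IsPair F x y' ∧ Commute y' w by
    obtain ⟨y', hy', hyw⟩ := this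
    obtain ⟨z, hz, hxz, hyz⟩ := hy'.exists_isPair_right hc hd hxw hyw hwF hw
    exact ⟨y', z, isQuadruple_iff.2 ⟨hy', hz, hxz, hxw, hyz, hyw⟩⟩
  by_cases hwy : Commute w y
  · exact ⟨y, h, hwy.symm⟩
  have hxy := h.2.2.2
  have hyw : Commute (w * y + y * w) w := by
    obtain ⟨γ, hγ⟩ := hw
    have h1 := Algebra.commutes γ y
    rw [commute_iff_eq]
    linear_combination (norm := grind) hγ * y - y * hγ - h1
  refine ⟨w * y + y * w, h.of_commute_right hc hd (fun h0 => hwy (CharTwo.add_eq_zero.1 h0))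
    ?_ ?_ hyw.symm hwy, hyw⟩
  · linear_combination (norm := grind) w * hxy + hxy * w + hxwe * y + y * hxwe
  · obtain ⟨β, hβ⟩ := h.2.2.1
    have h1 := Algebra.commutes β w
    rw [commute_iff_eq]
    linear_combination (norm := grind) h1 - hβ * w + w * hβ

omit hc hd in
theorem IsPair.exists_commute_of_left_eq (h : IsPair F x y) {y' z : A} (h' : IsPair F x y')
    (hxz : Commute x z) (hyz : Commute y z) (hzF : z ∉ Set.range (algebraMap F A)) :
    ∃ b ∉ Set.range (algebraMap F A), Commute x b ∧ Commute y b ∧ Commute y' b := by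
  have : CharP A 2 := charP_of_injective_algebraMap (algebraMap F A).injective 2
  have hxs := h.commute_mul_inv h'.2.2.2
  have hsy : y' * y⁻¹ * y = y' := inv_mul_cancel_right₀ h.1 y'
  obtain ⟨d, e, ⟨hxd, hyd⟩, ⟨hxe, hye⟩, hs, he⟩ := h.exists_eq_add_left_mul hxs
  have hse : Commute (y' * y⁻¹) e := by
    have h1 : y⁻¹ * y⁻¹ * y' = y' * (y⁻¹ * y⁻¹) := by
      obtain ⟨β, hβ⟩ := h.2.2.1
      have h5 : Commute (y ^ 2) y' := commute_of_mem_range ⟨β, hβ⟩ y'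
      have h6 := h5.inv_left₀.eq
      rwa [sq, mul_inv_rev] at h6
    have h2 : y * (y' * y') = y' * y' * y := by
      obtain ⟨β', hβ'⟩ := h'.2.2.1
      rw [← sq, ← hβ']
      exact (Algebra.commutes β' y).symm
    have h3 := inv_mul_cancel₀ h.1
    have h4 := mul_inv_cancel₀ h.1
    rw [commute_iff_eq, he]
    linear_combination (norm := noncomm_ring) y' * h3 * y' * y⁻¹ * y⁻¹ - y * y' * h1 * y⁻¹
      - h2 * y⁻¹ * y⁻¹ * y⁻¹ - y' * y' * h4 * y⁻¹ * y⁻¹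
  have hsd : Commute (y' * y⁻¹) d := by
    have h1 : d = y' * y⁻¹ + x * e := by
      rw [hs]
      grind
    rw [h1]
    exact (Commute.refl _).add_right (hxs.symm.mul_right hse)
  by_cases heF : e ∈ Set.range (algebraMap F A)
  · by_cases hdF : d ∈ Set.range (algebraMap F A)
    · refine ⟨z, hzF, hxz, hyz, ?_⟩
      rw [← hsy, hs]
      exact ((commute_of_mem_range hdF z).add_left
        (hxz.mul_left (commute_of_mem_range heF z))).mul_left hyz
    · exact ⟨d, hdF, hxd, hyd, hsy ▸ hsd.mul_left hyd⟩
  · exact ⟨e, heF, hxe, hye, hsy ▸ hse.mul_left hye⟩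

omit hc hd in
theorem IsPair.exists_commute_of_right_eq (h : IsPair F x y) {x' z : A} (h' : IsPair F x' y)
    (hxz : Commute x z) (hyz : Commute y z) (hzF : z ∉ Set.range (algebraMap F A)) :
    ∃ b ∉ Set.range (algebraMap F A), Commute x b ∧ Commute y b ∧ Commute x' b := by
  have : CharP A 2 := charP_of_injective_algebraMap (algebraMap F A).injective 2
  have hxy := h.2.2.2
  have hxy' := h'.2.2.2
  obtain ⟨α, hα⟩ := h.2.1
  obtain ⟨α', hα'⟩ := h'.2.1
  set v := x * x' + x' * x with hv
  have hvv : x * v + v * x = v := h.add_self_of_commutator x'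
  have hxe := h.commute_mul_inv hvv
  have hyv : Commute y v := by
    rw [commute_iff_eq]
    linear_combination (norm := grind) hxy * x' + x * hxy' + hxy' * x + x' * hxy
      + hxy + hxy'
  have htv : Commute (x + x') v := by
    have h1 := Algebra.commutes α' x
    rw [commute_iff_eq]
    linear_combination (norm := grind) hvv + h1 - hα' * x + x * hα'
  have hxt : x * (x + x') + (x + x') * x = v := by grind
  have hyt : Commute y (x + x') := by
    rw [commute_iff_eq]
    linear_combination (norm := grind) hxy + hxy'
  have hye : Commute y (v * y⁻¹) := hyv.mul_right (Commute.refl y).inv_right₀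
  have hte : Commute (x + x') (v * y⁻¹) := htv.mul_right hyt.symm.inv_right₀
  have hvy : v * y⁻¹ * y = v := inv_mul_cancel_right₀ h.1 v
  have hxd : Commute x (x + x' + v) := by
    rw [commute_iff_eq]
    linear_combination (norm := grind) hvv + hxt
  have hx' : x' = x + (x + x') := by grind
  by_cases heF : v * y⁻¹ ∈ Set.range (algebraMap F A)
  · by_cases hdF : x + x' + v ∈ Set.range (algebraMap F A)
    · refine ⟨z, hzF, hxz, hyz, ?_⟩
      have h1 : x' = x + ((x + x' + v) + v * y⁻¹ * y) := by
        rw [hvy]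
        grind
      rw [h1]
      exact hxz.add_left ((commute_of_mem_range hdF z).add_left
        ((commute_of_mem_range heF z).mul_left hyz))
    · refine ⟨_, hdF, hxd, hyt.add_right hyv, ?_⟩
      have h1 := hxd.add_left ((Commute.refl (x + x')).add_right htv)
      rwa [← hx'] at h1
  · refine ⟨_, heF, hxe, hye, ?_⟩
    have h1 := hxe.add_left hte
    rwa [← hx'] at h1

/-- An Artin–Schreier or square-central element of the centralizer of two quaternion subalgebras
`⟨x, y⟩` and `⟨x', y'⟩` extends the generators of both to quadruples with a common entry. -/
theorem IsPair.exists_isQuadruple_agree (h : IsPair F x y) {x' y' w : A} (h' : IsPair F x' y')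
    (hxw : Commute x w) (hyw : Commute y w) (hxw' : Commute x' w) (hyw' : Commute y' w)
    (hwF : w ∉ Set.range (algebraMap F A)) (hw : IsArtinSchreier F w ∨ IsSquareCentral F w) :
    ∃ z u z' u', IsQuadruple F (x, y, z, u) ∧ IsQuadruple F (x', y', z', u') ∧
      (z = z' ∨ u = u') := by
  rcases hw with hw | hw
  · obtain ⟨u, hu, hxu, hyu⟩ := h.exists_isPair_left hc hd hxw hyw hwF hw
    obtain ⟨u', hu', hxu', hyu'⟩ := h'.exists_isPair_left hc hd hxw' hyw' hwF hw
    exact ⟨w, u, w, u', isQuadruple_iff.2 ⟨h, hu, hxw, hxu, hyw, hyu⟩,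
      isQuadruple_iff.2 ⟨h', hu', hxw', hxu', hyw', hyu'⟩, Or.inl rfl⟩
  · obtain ⟨z, hz, hxz, hyz⟩ := h.exists_isPair_right hc hd hxw hyw hwF hw
    obtain ⟨z', hz', hxz', hyz'⟩ := h'.exists_isPair_right hc hd hxw' hyw' hwF hw
    exact ⟨z, w, z', w, isQuadruple_iff.2 ⟨h, hz, hxz, hxw, hyz, hyw⟩,
      isQuadruple_iff.2 ⟨h', hz', hxz', hxw', hyz', hyw'⟩, Or.inr rfl⟩

/-- A quaternion subalgebra `⟨x, y⟩` extends to a quadruple as soon as the centralizer of `x` is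
not commutative. -/
theorem IsPair.exists_isQuadruple (h : IsPair F x y) {p q : A} (hxp : Commute x p)
    (hxq : Commute x q) (hpq : ¬ Commute p q) : ∃ z u, IsQuadruple F (x, y, z, u) := by
  obtain ⟨b, hbF, hxb, hyb⟩ :
      ∃ b ∉ Set.range (algebraMap F A), Commute x b ∧ Commute y b := by
    by_contra! hcon
    obtain ⟨d, e, hd, he, rfl, -⟩ := h.exists_eq_add_left_mul hxp
    have hdF : d ∈ Set.range (algebraMap F A) := by
      by_contra hdF
      exact hcon d hdF hd.1 hd.2
    have heF : e ∈ Set.range (algebraMap F A) := by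
      by_contra heF
      exact hcon e heF he.1 he.2
    exact hpq ((commute_of_mem_range hdF q).add_left
      (hxq.mul_left (commute_of_mem_range heF q)))
  obtain ⟨t, n, hb⟩ := h.exists_quadratic hc hd hxb hyb hbF
  obtain ⟨w, hwF, hw, hbw⟩ := exists_artinSchreier_or_squareCentral hbF hb
  obtain ⟨z, u, -, -, hQ, -⟩ := h.exists_isQuadruple_agree hc hd h (hbw x hxb) (hbw y hyb)
    (hbw x hxb) (hbw y hyb) hwF hw
  exact ⟨z, u, hQ⟩

end Biquaternion

end CharTwo

section Chains

variable {A : Type*}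

/-- Two quadruples are linked if a `Π`-step, a `Λ₂`-step and a `Π`-step lead from the first to the
second. -/
def IsLinked (F : Type*) [Field F] [Ring A] [Algebra F A] (Q Q' : A × A × A × A) : Prop :=
  ∃ R S, IsQuadruple F R ∧ IsQuadruple F S ∧ PiStep Q R ∧ Lambda2Step R S ∧ PiStep S Q'

theorem PiStep.of_quadSwap_left {Q R : A × A × A × A} (h : PiStep (quadSwap Q) R) :
    PiStep Q R := by
  simp only [PiStep, AgreePair, quadSwap] at h ⊢
  tauto

theorem PiStep.of_quadSwap_right {Q R : A × A × A × A} (h : PiStep Q (quadSwap R)) :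
    PiStep Q R := by
  simp only [PiStep, AgreePair, quadSwap] at h ⊢
  tauto

theorem IsQuadruple.quadSwap {F : Type*} [Field F] [Ring A] [Algebra F A] {Q : A × A × A × A}
    (h : IsQuadruple F Q) : IsQuadruple F (quadSwap Q) := by
  obtain ⟨x, y, z, u⟩ := Q
  obtain ⟨hxy, hzu, hxz, hxu, hyz, hyu⟩ := isQuadruple_iff.1 h
  exact isQuadruple_iff.2 ⟨hzu, hxy, hxz.symm, hyz.symm, hxu.symm, hyu.symm⟩

variable {F : Type*} [Field F] [CharP F 2] [DivisionRing A] [Algebra F A]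

namespace IsLinked

omit [CharP F 2] in
theorem of_quadSwap_left {Q R : A × A × A × A} (h : IsLinked F (quadSwap Q) R) :
    IsLinked F Q R := by
  obtain ⟨S, T, hS, hT, h1, h2, h3⟩ := h
  exact ⟨S, T, hS, hT, h1.of_quadSwap_left, h2, h3⟩

omit [CharP F 2] in
theorem of_quadSwap_right {Q R : A × A × A × A} (h : IsLinked F Q (quadSwap R)) :
    IsLinked F Q R := by
  obtain ⟨S, T, hS, hT, h1, h2, h3⟩ := h
  exact ⟨S, T, hS, hT, h1, h2, h3.of_quadSwap_right⟩

omit [CharP F 2] in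
theorem refl {Q : A × A × A × A} (hQ : IsQuadruple F Q) : IsLinked F Q Q :=
  ⟨Q, Q, hQ, hQ, Or.inl (Or.inl ⟨rfl, rfl⟩), Or.inl ⟨Or.inl rfl, Or.inl rfl⟩,
    Or.inl (Or.inl ⟨rfl, rfl⟩)⟩

variable (hc : Subalgebra.center F A = ⊥) (hd : Module.finrank F A = 16)

include hc hd

/-- Quadruples whose first pairs share an entry are linked. -/
theorem of_agree {x y z u x' y' z' u' : A} (hQ : IsQuadruple F (x, y, z, u))
    (hQ' : IsQuadruple F (x', y', z', u')) (h : x = x' ∨ y = y') :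
    IsLinked F (x, y, z, u) (x', y', z', u') := by
  obtain ⟨hxy, hzu, hxz, -, hyz, -⟩ := isQuadruple_iff.1 hQ
  obtain ⟨hxy', -⟩ := isQuadruple_iff.1 hQ'
  obtain ⟨b, hbF, hxb, hyb, hxb', hyb'⟩ : ∃ b ∉ Set.range (algebraMap F A),
      Commute x b ∧ Commute y b ∧ Commute x' b ∧ Commute y' b := by
    rcases h with rfl | rfl
    · obtain ⟨b, hbF, hxb, hyb, hyb'⟩ :=
        hxy.exists_commute_of_left_eq hxy' hxz hyz hzu.left_notMem
      exact ⟨b, hbF, hxb, hyb, hxb, hyb'⟩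
    · obtain ⟨b, hbF, hxb, hyb, hxb'⟩ :=
        hxy.exists_commute_of_right_eq hxy' hxz hyz hzu.left_notMem
      exact ⟨b, hbF, hxb, hyb, hxb', hyb⟩
  obtain ⟨t, n, hb⟩ := hxy.exists_quadratic hc hd hxb hyb hbF
  obtain ⟨w, hwF, hw, hbw⟩ := exists_artinSchreier_or_squareCentral hbF hb
  obtain ⟨p, q, p', q', hR, hS, hpq⟩ := hxy.exists_isQuadruple_agree hc hd hxy' (hbw x hxb)
    (hbw y hyb) (hbw x' hxb') (hbw y' hyb') hwF hw
  exact ⟨_, _, hR, hS, Or.inl (Or.inl ⟨rfl, rfl⟩), Or.inl ⟨h, hpq⟩, Or.inl (Or.inl ⟨rfl, rfl⟩)⟩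

/-- Quadruples whose second pairs share an entry are linked. -/
theorem of_agree_right {x y z u x' y' z' u' : A} (hQ : IsQuadruple F (x, y, z, u))
    (hQ' : IsQuadruple F (x', y', z', u')) (h : z = z' ∨ u = u') :
    IsLinked F (x, y, z, u) (x', y', z', u') :=
  of_quadSwap_left (of_quadSwap_right (of_agree hc hd hQ.quadSwap hQ'.quadSwap h))

end IsLinked

variable (hc : Subalgebra.center F A = ⊥) (hd : Module.finrank F A = 16)

include hc hd

/-- Quadruples whose first entries do not commute have neighbours that share an entry. -/
theorem exists_isQuadruple_agree_of_not_commute {x y z u x' y' z' u' : A}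
    (hQ : IsQuadruple F (x, y, z, u)) (hQ' : IsQuadruple F (x', y', z', u'))
    (hxx' : ¬ Commute x x') :
    ∃ y₁ z₁ u₁ y₂ z₂ u₂, IsQuadruple F (x, y₁, z₁, u₁) ∧ IsQuadruple F (x', y₂, z₂, u₂) ∧
      (z₁ = z₂ ∨ u₁ = u₂) := by
  have : CharP A 2 := charP_of_injective_algebraMap (algebraMap F A).injective 2
  have : FiniteDimensional F A := FiniteDimensional.of_finrank_pos (by lia)
  obtain ⟨hxy, hzu, hxz, hxu, -⟩ := isQuadruple_iff.1 hQ
  obtain ⟨hxy', -⟩ := isQuadruple_iff.1 hQ'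
  obtain ⟨α, hα⟩ := hxy.2.1
  obtain ⟨α', hα'⟩ := hxy'.2.1
  have hv := hxy.add_self_of_commutator x'
  have hv' : x' * (x * x' + x' * x) + (x * x' + x' * x) * x' = x * x' + x' * x := by
    rw [add_comm (x * x')]
    exact hxy'.add_self_of_commutator x
  have hα1 := Algebra.commutes α x'
  have hα2 := Algebra.commutes α' x
  have hxm : Commute x ((x + x') ^ 2) := by
    rw [commute_iff_eq]
    linear_combination (norm := grind) hv + hα2 - hα' * x + x * hα'
  have hxm' : Commute x' ((x + x') ^ 2) := by
    rw [commute_iff_eq]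
    linear_combination (norm := grind) hv' + hα1 - hα * x' + x' * hα
  by_cases hm : (x + x') ^ 2 ∈ Set.range (algebraMap F A)
  · obtain ⟨μ, hμ⟩ := hm
    have hve : x * x' + x' * x = algebraMap F A (μ + α + α') + (x + x') := by
      rw [map_add, map_add]
      linear_combination (norm := grind) hμ + hα + hα'
    have hvF : IsSquareCentral F (x * x' + x' * x) := by
      refine ⟨(μ + α + α') ^ 2 + μ, ?_⟩
      have h1 := Algebra.commutes (μ + α + α') (x + x')
      rw [hve, map_add, map_pow]
      linear_combination (norm := grind) hμ + h1
    have hv0 : x * x' + x' * x ≠ 0 := fun h0 => hxx' (CharTwo.add_eq_zero.1 h0)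
    have hxv : IsPair F x (x * x' + x' * x) := ⟨hv0, hxy.2.1, hvF, hv⟩
    have hxv' : IsPair F x' (x * x' + x' * x) := ⟨hv0, hxy'.2.1, hvF, hv'⟩
    obtain ⟨p, q, hR⟩ := hxv.exists_isQuadruple hc hd hxz hxu hzu.not_commute
    obtain ⟨-, hpq, hxp, hxq, hvp, hvq⟩ := isQuadruple_iff.1 hR
    have key : ∀ b, Commute x b → Commute (x * x' + x' * x) b → Commute x' b := by
      intro b hxb hvb
      have h1 : x' = x * x' + x' * x + algebraMap F A (μ + α + α') + x := by
        rw [hve]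
        grind
      rw [h1]
      exact (hvb.add_left (Algebra.commutes _ b)).add_left hxb
    exact ⟨_, p, q, _, p, q, hR,
      isQuadruple_iff.2 ⟨hxv', hpq, key p hxp hvp, key q hxq hvq, hvp, hvq⟩, Or.inl rfl⟩
  · obtain ⟨t, n, hmq⟩ : ∃ t n : F, ((x + x') ^ 2) ^ 2 =
        algebraMap F A t * (x + x') ^ 2 + algebraMap F A n := by
      obtain ⟨a, ha⟩ : ∃ a, ¬ Commute ((x + x') ^ 2) a := by
        by_contra! hcon
        exact hm (mem_range_of_forall_commute hc fun a => (hcon a).symm)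
      have h1 := two_mul_finrank_centralizer_insert_le (F := F) (S := ∅) (q := a) (by simp) ha
      have h2 := two_mul_finrank_centralizer_insert_le (F := F) (S := {(x + x') ^ 2}) (b := x)
        (q := x') (by simpa using hxm'.symm) hxx'
      have h3 := two_mul_finrank_centralizer_insert_le (F := F) (S := {x, (x + x') ^ 2})
        (b := x') (q := x) (by simpa using hxm.symm) fun h => hxx' h.symm
      have h4 := Submodule.finrank_le
        (Subalgebra.toSubmodule (Subalgebra.centralizer F (∅ : Set A)))
      rw [Subalgebra.finrank_toSubmodule] at h4
      rw [insert_empty_eq] at h1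
      exact exists_quadratic_of_finrank_centralizer_le (S := {x', x, (x + x') ^ 2}) (by lia)
        (by simp [hxm, hxm']) hm
    obtain ⟨w, hwF, hw, hmw⟩ := exists_artinSchreier_or_squareCentral hm hmq
    have hxw := hmw x hxm
    have hxw' := hmw x' hxm'
    rcases hw with hw | hw
    · have hxwF : x + w ∉ Set.range (algebraMap F A) := fun h => hxx' <| by
        have h1 := (commute_of_mem_range h x').add_left hxw'.symm
        rwa [CharTwo.add_cancel_right] at h1
      have hxwF' : x' + w ∉ Set.range (algebraMap F A) := fun h => hxx' <| by
        have h1 := (commute_of_mem_range h x).add_left hxw.symm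
        rw [CharTwo.add_cancel_right] at h1
        exact h1.symm
      obtain ⟨y₁, u₁, h₁⟩ := hxy.exists_isQuadruple_of_isArtinSchreier hc hd hxw hwF hxwF hw
      obtain ⟨y₂, u₂, h₂⟩ := hxy'.exists_isQuadruple_of_isArtinSchreier hc hd hxw' hwF hxwF' hw
      exact ⟨_, _, _, _, _, _, h₁, h₂, Or.inl rfl⟩
    · obtain ⟨y₁, z₁, h₁⟩ := hxy.exists_isQuadruple_of_isSquareCentral hc hd hxw hwF hw
      obtain ⟨y₂, z₂, h₂⟩ := hxy'.exists_isQuadruple_of_isSquareCentral hc hd hxw' hwF hw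
      exact ⟨_, _, _, _, _, _, h₁, h₂, Or.inr rfl⟩

/-- Any two quadruples are connected by three links. -/
theorem exists_isLinked_three {Q Q' : A × A × A × A} (hQ : IsQuadruple F Q)
    (hQ' : IsQuadruple F Q') : ∃ R S, IsQuadruple F R ∧ IsQuadruple F S ∧ IsLinked F Q R ∧
      IsLinked F R S ∧ IsLinked F S Q' := by
  have : CharP A 2 := charP_of_injective_algebraMap (algebraMap F A).injective 2
  obtain ⟨x, y, z, u⟩ := Q
  obtain ⟨x', y', z', u'⟩ := Q'
  by_cases hxx' : Commute x x'
  · obtain ⟨hxy, hzu, hxz, hxu, hyz, hyu⟩ := isQuadruple_iff.1 hQ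
    obtain ⟨hxy', -⟩ := isQuadruple_iff.1 hQ'
    by_cases hF : x + x' ∈ Set.range (algebraMap F A)
    · have hcm : ∀ b, Commute x b → Commute x' b := by
        intro b hxb
        have h1 := hxb.add_left (commute_of_mem_range hF b)
        rwa [CharTwo.add_cancel_left] at h1
      have hx'y : x' * y + y * x' = y := by
        have h1 := (commute_of_mem_range hF y).eq
        linear_combination (norm := grind) h1 + hxy.2.2.2
      have hR : IsQuadruple F (x', y, z, u) := isQuadruple_iff.2
        ⟨⟨hxy.1, hxy'.2.1, hxy.2.2.1, hx'y⟩, hzu, hcm z hxz, hcm u hxu, hyz, hyu⟩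
      exact ⟨_, _, hR, hQ', IsLinked.of_agree hc hd hQ hR (Or.inr rfl),
        IsLinked.of_agree hc hd hR hQ' (Or.inl rfl), IsLinked.refl hQ'⟩
    · obtain ⟨y₁, u₁, hR⟩ := hxy.exists_isQuadruple_of_isArtinSchreier hc hd hxx'
        hxy'.left_notMem hF hxy'.2.1
      exact ⟨_, _, hR, hQ', IsLinked.of_agree hc hd hQ hR (Or.inl rfl),
        (IsLinked.of_agree hc hd hR.quadSwap hQ' (Or.inl rfl)).of_quadSwap_left,
        IsLinked.refl hQ'⟩
  · obtain ⟨y₁, z₁, u₁, y₂, z₂, u₂, hR, hS, h⟩ :=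
      exists_isQuadruple_agree_of_not_commute hc hd hQ hQ' hxx'
    exact ⟨_, _, hR, hS, IsLinked.of_agree hc hd hQ hR (Or.inl rfl),
      IsLinked.of_agree_right hc hd hR hS h, IsLinked.of_agree hc hd hS hQ' (Or.inl rfl)⟩

end Chains

/-- Every two quadruples of generators of a biquaternion division algebra are connected by a
chain of at most fifteen steps, at most nine of which are of type `Π` and at most six of
type `Λ₂`. -/
theorem pi_lambda2_chain (F A : Type*) [Field F] [CharP F 2] [DivisionRing A] [Algebra F A]
    (hcentral : Subalgebra.center F A = ⊥) (hdim : Module.finrank F A = 16)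
    (hbiquat : ∃ q : A × A × A × A, IsQuadruple F q)
    (Q Q' : A × A × A × A) (hQ : IsQuadruple F Q) (hQ' : IsQuadruple F Q') :
    ∃ n ≤ 15, ∃ c : ℕ → A × A × A × A, ∃ t : ℕ → Bool,
      c 0 = Q ∧ c n = Q' ∧ (∀ i ≤ n, IsQuadruple F (c i)) ∧
      (∀ i < n, if t i then PiStep (c i) (c (i + 1)) else Lambda2Step (c i) (c (i + 1))) ∧
      ((Finset.range n).filter fun i => t i = true).card ≤ 9 ∧
      ((Finset.range n).filter fun i => t i = false).card ≤ 6 := by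

  obtain ⟨Q₃, Q₆, hQ₃, hQ₆, ⟨Q₁, Q₂, hQ₁, hQ₂, h₀, h₁, h₂⟩, ⟨Q₄, Q₅, hQ₄, hQ₅, h₃, h₄, h₅⟩,
    ⟨Q₇, Q₈, hQ₇, hQ₈, h₆, h₇, h₈⟩⟩ := exists_isLinked_three hcentral hdim hQ hQ'
  refine ⟨9, by norm_num,
    fun i => [Q, Q₁, Q₂, Q₃, Q₄, Q₅, Q₆, Q₇, Q₈, Q'].getD i Q, fun i => decide (i % 3 ≠ 1),
    rfl, rfl, fun i hi => ?_, fun i hi => ?_, by decide, by decide⟩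
  · interval_cases i <;> assumption
  · interval_cases i <;> assumption
end
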